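/- arXiv:0910.0890 — 3 statements merged into one kernel-verified Lean document; each statement's English description precedes it below -/
import Mathlib

section
/- (Theorem A, axially symmetric case, ODE form) Let 1 < ρ ≤ 2. Suppose u : [−1,1] → ℝ is continuous on [−1,1], is C² on (−1,1), and satisfies the ordinary differential equation d/dt[(1−t²) u'(t)] + 2ρ (e^{u(t)} − 1) = 0 for all t ∈ (−1,1). Then u ≡ 0 on [−1,1]. -/
open Real Set

/-- First-order form of the ODE on the open interval, with `G = (1-t²)u'`. -/
structure AxSys (ρ : ℝ) (u G : ℝ → ℝ) : Prop where
  hu : ∀ t ∈ Ioo (-1 : ℝ) 1, HasDerivAt u (G t / (1 - t ^ 2)) t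
  hG : ∀ t ∈ Ioo (-1 : ℝ) 1, HasDerivAt G (-2 * ρ * (exp (u t) - 1)) t
  uc : ContinuousOn u (Icc (-1) 1)

/-- The system together with the boundary behaviour of `G`. -/
structure AxSysB (ρ : ℝ) (u G : ℝ → ℝ) : Prop extends AxSys ρ u G where
  Gc : ContinuousOn G (Icc (-1) 1)
  G1 : G 1 = 0
  Gm1 : G (-1) = 0

theorem AxSys.reflect {ρ : ℝ} {u G : ℝ → ℝ} (h : AxSys ρ u G) :
    AxSys ρ (fun t => u (-t)) (fun t => -G (-t)) := by
  refine ⟨fun t ht => ?_, fun t ht => ?_, ?_⟩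
  · have h1 := h.hu (-t) ⟨by linarith [ht.2], by linarith [ht.1]⟩
    have h2 := h1.comp t (hasDerivAt_neg t)
    refine h2.congr_deriv ?_
    rw [neg_sq]; ring
  · have h1 := h.hG (-t) ⟨by linarith [ht.2], by linarith [ht.1]⟩
    have h2 := (h1.comp t (hasDerivAt_neg t)).neg
    refine h2.congr_deriv ?_
    ring
  · refine h.uc.comp (by fun_prop) ?_
    intro t ht
    exact ⟨by linarith [ht.2], by linarith [ht.1]⟩

theorem AxSysB.reflect {ρ : ℝ} {u G : ℝ → ℝ} (h : AxSysB ρ u G) :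
    AxSysB ρ (fun t => u (-t)) (fun t => -G (-t)) := by
  refine ⟨h.toAxSys.reflect, ?_, by simp [h.Gm1], by simp [h.G1]⟩
  refine (h.Gc.comp (f := fun t => -t) (by fun_prop) ?_).neg
  intro t ht
  exact ⟨by linarith [ht.2], by linarith [ht.1]⟩

/-- `G` vanishes at the right end point. -/
theorem AxSys.tendsto_right {ρ : ℝ} {u G : ℝ → ℝ} (h : AxSys ρ u G) :
    Filter.Tendsto G (nhdsWithin 1 (Iio 1)) (nhds 0) := by
  set f : ℝ → ℝ := fun t => -2 * ρ * (exp (IccExtend (by norm_num : (-1:ℝ) ≤ 1)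
    ((Icc (-1:ℝ) 1).domRestrict u) t) - 1) with hf
  have hfc : Continuous f := by
    have : Continuous (IccExtend (by norm_num : (-1:ℝ) ≤ 1) ((Icc (-1:ℝ) 1).domRestrict u)) :=
      (continuousOn_iff_continuous_domRestrict.1 h.uc).Icc_extend'
    fun_prop
  set g : ℝ → ℝ := fun t => G 0 + ∫ x in (0:ℝ)..t, f x with hg
  have hgd : ∀ t, HasDerivAt g (f t) t := fun t =>
    (intervalIntegral.integral_hasDerivAt_right (hfc.intervalIntegrable _ _)
      (hfc.stronglyMeasurableAtFilter _ _) hfc.continuousAt).const_add _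
  have hfu : ∀ t ∈ Ioo (-1:ℝ) 1, f t = -2 * ρ * (exp (u t) - 1) := by
    intro t ht
    simp only [hf]
    rw [IccExtend_of_mem _ _ (Ioo_subset_Icc_self ht)]
    rfl
  have hEq : EqOn G g (Ioo (-1) 1) := by
    refine isOpen_Ioo.eqOn_of_deriv_eq isPreconnected_Ioo
      (fun t ht => (h.hG t ht).differentiableAt.differentiableWithinAt)
      (fun t ht => (hgd t).differentiableAt.differentiableWithinAt) ?_
      (x := 0) (by norm_num) (by simp [hg])
    intro t ht
    rw [(h.hG t ht).deriv, (hgd t).deriv, hfu t ht]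
  have hgc : Continuous g := continuous_iff_continuousAt.2 fun t => (hgd t).continuousAt
  have hg1 : g 1 = 0 := by
    by_contra hne
    set η := |g 1| / 4 with hη
    have hηp : 0 < η := by positivity
    obtain ⟨d1, hd1, H1⟩ := Metric.continuousAt_iff.1 (hgc.continuousAt (x := 1)) (2 * η)
      (by linarith)
    obtain ⟨d2, hd2, H2⟩ := Metric.continuousWithinAt_iff.1
      (h.uc 1 (by norm_num)) (η / 4) (by linarith)
    set ε := min (min d1 d2 / 4) (1 / 4) with hε
    have hεp : 0 < ε := by positivity
    have he1 : ε ≤ d1 / 4 :=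
      (min_le_left _ _).trans (div_le_div_of_nonneg_right (min_le_left _ _) (by norm_num))
    have he2 : ε ≤ d2 / 4 :=
      (min_le_left _ _).trans (div_le_div_of_nonneg_right (min_le_right _ _) (by norm_num))
    have he3 : ε ≤ 1 / 4 := min_le_right _ _
    obtain ⟨ξ, hξ, hξe⟩ := exists_hasDerivAt_eq_slope u (fun t => G t / (1 - t ^ 2))
      (a := 1 - 2 * ε) (b := 1 - ε) (by linarith)
      (h.uc.mono (Icc_subset_Icc (by linarith) (by linarith)))
      (fun x hx => h.hu x ⟨by linarith [hx.1], by linarith [hx.2]⟩)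
    have hξ' : ξ ∈ Ioo (-1:ℝ) 1 := ⟨by linarith [hξ.1], by linarith [hξ.2]⟩
    have a1 := H1 (x := ξ) (by rw [Real.dist_eq, abs_lt]; constructor <;> linarith [hξ.1, hξ.2])
    have a2 := H2 (x := 1 - ε) ⟨by linarith, by linarith⟩
      (by rw [Real.dist_eq, abs_lt]; constructor <;> linarith)
    have a3 := H2 (x := 1 - 2 * ε) ⟨by linarith, by linarith⟩
      (by rw [Real.dist_eq, abs_lt]; constructor <;> linarith)
    rw [Real.dist_eq] at a1 a2 a3
    rw [← hEq hξ'] at a1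
    have hpos : 0 < 1 - ξ ^ 2 := by nlinarith [hξ'.1, hξ'.2]
    have hle : 1 - ξ ^ 2 ≤ 4 * ε := by nlinarith [hξ'.1, hξ'.2, hξ.1, hξ.2]
    have hden : (1 - ε) - (1 - 2 * ε) = ε := by ring
    rw [hden, div_eq_div_iff hpos.ne' hεp.ne'] at hξe
    have hD : |u (1 - ε) - u (1 - 2 * ε)| ≤ η / 2 := by
      rw [abs_lt] at a2 a3
      rw [abs_le]
      constructor <;> linarith [a2.1, a2.2, a3.1, a3.2]
    have hGb : |G ξ| * ε ≤ (η / 2) * (4 * ε) := by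
      calc |G ξ| * ε = |G ξ * ε| := by rw [abs_mul, abs_of_pos hεp]
        _ = |u (1 - ε) - u (1 - 2 * ε)| * (1 - ξ ^ 2) := by
          rw [hξe, abs_mul, abs_of_pos hpos]
        _ ≤ _ := mul_le_mul hD hle hpos.le (by linarith)
    have hGb' : |G ξ| ≤ 2 * η := by nlinarith
    have : |g 1| ≤ |G ξ| + |G ξ - g 1| := by
      have := abs_sub_abs_le_abs_sub (g 1) (G ξ)
      rw [abs_sub_comm] at this
      linarith
    have h4 : |g 1| = 4 * η := by rw [hη]; ring
    linarith
  have : Filter.Tendsto g (nhdsWithin 1 (Iio 1)) (nhds 0) := by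
    have := hgc.tendsto 1
    rw [hg1] at this
    exact this.mono_left nhdsWithin_le_nhds
  refine this.congr' ?_
  filter_upwards [Ioo_mem_nhdsLT (by norm_num : (-1:ℝ) < 1)] with t ht
  exact (hEq ht).symm

/-- A sign condition on the derivative at the left end of a positivity interval. -/
theorem deriv_nonneg_left {f : ℝ → ℝ} {a b f' : ℝ} (hab : a < b) (hf : HasDerivAt f f' a)
    (h0 : f a = 0) (hp : ∀ x ∈ Ioo a b, 0 < f x) : 0 ≤ f' := by
  have h1 : Filter.Tendsto (slope f a) (nhdsWithin a (Ioi a)) (nhds f') :=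
    hf.tendsto_slope.mono_left (nhdsWithin_mono _ fun x hx => ne_of_gt hx)
  refine ge_of_tendsto h1 ?_
  filter_upwards [Ioo_mem_nhdsGT hab] with x hx
  rw [slope_def_field, h0]
  exact div_nonneg (by linarith [hp x hx]) (by linarith [hx.1])

theorem deriv_nonpos_right {f : ℝ → ℝ} {a b f' : ℝ} (hab : a < b) (hf : HasDerivAt f f' b)
    (h0 : f b = 0) (hp : ∀ x ∈ Ioo a b, 0 < f x) : f' ≤ 0 := by
  have h1 : Filter.Tendsto (slope f b) (nhdsWithin b (Iio b)) (nhds f') :=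
    hf.tendsto_slope.mono_left (nhdsWithin_mono _ fun x hx => ne_of_lt hx)
  refine le_of_tendsto h1 ?_
  filter_upwards [Ioo_mem_nhdsLT hab] with x hx
  rw [slope_def_field, h0]
  exact div_nonpos_of_nonneg_of_nonpos (by linarith [hp x hx]) (by linarith [hx.2])

/-- Core: there is no interval `(a,b)` in `[0,1]` on which `G` has a sign and vanishes at the ends. -/
theorem AxSysB.no_interval {ρ : ℝ} {u G : ℝ → ℝ} (h : AxSysB ρ u G) (hρ1 : 1 < ρ) (hρ2 : ρ ≤ 2)
    {a b σ : ℝ} (ha : 0 ≤ a) (hab : a < b) (hb : b ≤ 1) (hGa : G a = 0) (hGb : G b = 0)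
    (hs : ∀ x ∈ Ioo a b, 0 < σ * G x) : False := by
  set K : ℝ → ℝ := fun t => (1 - t) * (4 - 2 * ρ * (1 - t)) * (-2 * ρ * (exp (u t) - 1))
    + (4 - 4 * ρ * (1 - t)) * G t - G t ^ 2 with hK
  have hsub : Icc a b ⊆ Icc (-1) 1 := Icc_subset_Icc (by linarith) hb
  have huc := h.uc.mono hsub
  have hGc := h.Gc.mono hsub
  have hKc : ContinuousOn (fun t => σ * K t) (Icc a b) := by
    simp only [hK]
    fun_prop
  have hKd : ∀ t ∈ Ioo a b, HasDerivAt K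
      (G t * (4 * ρ * (ρ - 1) * exp (u t) * (1 - t) / (1 + t))) t := by
    intro t ht
    have ht' : t ∈ Ioo (-1:ℝ) 1 := ⟨by linarith [ht.1], by linarith [ht.2]⟩
    have h1 := h.hu t ht'
    have h2 := h.hG t ht'
    have hid := hasDerivAt_id' t
    have e1 : HasDerivAt (fun t : ℝ => 1 - t) (-1) t := by simpa using hid.const_sub 1
    have e2 := (e1.const_mul (2 * ρ)).const_sub 4
    have e3 := (e1.const_mul (4 * ρ)).const_sub 4
    have e4 := (h1.exp.sub_const 1).const_mul (-2 * ρ)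
    have e := (((e1.mul e2).mul e4).add (e3.mul h2)).sub (h2.pow 2)
    refine e.congr_deriv ?_
    have p1 : (1 + t) ≠ 0 := by linarith [ht'.1]
    have p2 : (1 - t) ≠ 0 := by linarith [ht'.2]
    have p3 : 1 - t ^ 2 = (1 - t) * (1 + t) := by ring
    simp only [Pi.mul_apply]
    rw [p3]
    field_simp
    ring
  have hmono : StrictMonoOn (fun t => σ * K t) (Icc a b) := by
    refine strictMonoOn_of_deriv_pos (convex_Icc a b) hKc ?_
    rw [interior_Icc]
    intro t ht
    rw [((hKd t ht).const_mul σ).deriv]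
    have := hs t ht
    have q1 : 0 < 1 - t := by linarith [ht.2]
    have q2 : 0 < 1 + t := by linarith [ht.1]
    have q3 : 0 < ρ - 1 := by linarith
    rw [← mul_assoc]
    positivity
  have hlt := hmono (left_mem_Icc.2 hab.le) (right_mem_Icc.2 hab.le) hab
  have haI : a ∈ Ioo (-1:ℝ) 1 := ⟨by linarith, by linarith⟩
  have hda := deriv_nonneg_left hab ((h.hG a haI).const_mul σ) (by simp [hGa]) hs
  have w : ∀ x : ℝ, 0 ≤ x → x ≤ 1 → 0 ≤ (1 - x) * (4 - 2 * ρ * (1 - x)) := by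
    intro x hx hx1
    refine mul_nonneg (by linarith) ?_
    nlinarith
  have hKa : 0 ≤ σ * K a := by
    have := mul_nonneg (w a ha (by linarith)) hda
    simp only [hK, hGa]
    nlinarith
  have hKb : σ * K b ≤ 0 := by
    rcases hb.lt_or_eq with hb1 | hb1
    · have hdb := deriv_nonpos_right hab
        ((h.hG b ⟨by linarith, hb1⟩).const_mul σ) (by simp [hGb]) hs
      have := mul_nonneg (w b (by linarith) hb) (neg_nonneg.2 hdb)
      simp only [hK, hGb]
      nlinarith
    · simp [hK, hb1, h.G1]
  simp only at hlt
  linarith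

theorem AxSysB.zero_right {ρ : ℝ} {u G : ℝ → ℝ} (h : AxSysB ρ u G) (hρ1 : 1 < ρ) (hρ2 : ρ ≤ 2)
    {t₀ : ℝ} (h0 : 0 ≤ t₀) (hG0 : G t₀ = 0) : ∀ t ∈ Icc t₀ 1, G t = 0 := by
  intro t ht
  by_contra hne
  have hc : ContinuousOn G (Icc t₀ 1) := h.Gc.mono (Icc_subset_Icc (by linarith) le_rfl)
  have hA : IsCompact (Icc t₀ t ∩ G ⁻¹' {0}) :=
    isCompact_Icc.of_isClosed_subset ((hc.mono (Icc_subset_Icc le_rfl ht.2)).preimage_isClosed_of_isClosed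
      isClosed_Icc isClosed_singleton) inter_subset_left
  have hB : IsCompact (Icc t 1 ∩ G ⁻¹' {0}) :=
    isCompact_Icc.of_isClosed_subset ((hc.mono (Icc_subset_Icc ht.1 le_rfl)).preimage_isClosed_of_isClosed
      isClosed_Icc isClosed_singleton) inter_subset_left
  obtain ⟨a, ⟨ha, hGa⟩, hamax⟩ := hA.exists_isGreatest ⟨t₀, ⟨le_rfl, ht.1⟩, hG0⟩
  obtain ⟨b, ⟨hb, hGb⟩, hbmin⟩ := hB.exists_isLeast ⟨1, ⟨ht.2, le_rfl⟩, h.G1⟩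
  have hGa' : G a = 0 := hGa
  have hGb' : G b = 0 := hGb
  have hat : a < t := lt_of_le_of_ne ha.2 (by rintro rfl; exact hne hGa')
  have htb : t < b := lt_of_le_of_ne hb.1 (by rintro rfl; exact hne hGb')
  refine h.no_interval hρ1 hρ2 (a := a) (b := b) (σ := G t) (by linarith [ha.1])
    (by linarith) hb.2 hGa' hGb' ?_
  intro x hx
  by_contra hneg
  push Not at hneg
  have hxt : uIcc t x ⊆ Ioo a b := by
    intro y hy
    rcases mem_uIcc.1 hy with hy | hy
    · exact ⟨by linarith [hy.1], by linarith [hy.2, hx.2]⟩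
    · exact ⟨by linarith [hy.1, hx.1], by linarith [hy.2]⟩
  have hcc : ContinuousOn (fun y => G t * G y) (uIcc t x) := by
    refine continuousOn_const.mul (hc.mono (hxt.trans ?_))
    intro y hy
    exact ⟨by linarith [hy.1, ha.1], by linarith [hy.2, hb.2]⟩
  have hpos : 0 < G t * G t := mul_self_pos.2 hne
  obtain ⟨y, hy, hy0⟩ := intermediate_value_uIcc hcc
    (mem_uIcc.2 (Or.inr ⟨hneg, hpos.le⟩) : (0:ℝ) ∈ uIcc (G t * G t) (G t * G x))
  have hGy : G y = 0 := by
    rcases mul_eq_zero.1 hy0 with h' | h'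
    · exact absurd h' hne
    · exact h'
  have hyI := hxt hy
  rcases le_total y t with h' | h'
  · have := hamax ⟨⟨by linarith [hyI.1, ha.1], h'⟩, hGy⟩
    linarith [hyI.1]
  · have := hbmin ⟨⟨h', by linarith [hyI.2, hb.2]⟩, hGy⟩
    linarith [hyI.2]

/-- Backward uniqueness. -/
theorem AxSys.unique_left {ρ : ℝ} {u G : ℝ → ℝ} (h : AxSys ρ u G) (hρ : 0 < ρ) {s c : ℝ}
    (hs : -1 < s) (hsc : s ≤ c) (hc : c < 1) (hu0 : u c = 0) (hG0 : G c = 0) : u s = 0 := by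
  have hsub : ∀ x ∈ Icc s c, x ∈ Ioo (-1:ℝ) 1 := fun x hx =>
    ⟨by linarith [hx.1], by linarith [hx.2]⟩
  have huc : ContinuousOn u (Icc s c) := fun x hx =>
    (h.hu x (hsub x hx)).continuousAt.continuousWithinAt
  have hGc : ContinuousOn G (Icc s c) := fun x hx =>
    (h.hG x (hsub x hx)).continuousAt.continuousWithinAt
  obtain ⟨M, hM⟩ := isCompact_Icc.exists_bound_of_continuousOn huc
  have hic : ContinuousOn (fun x : ℝ => 1 / (1 - x ^ 2)) (Icc s c) := by
    refine ContinuousOn.div continuousOn_const (by fun_prop) fun x hx => ?_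
    have := hsub x hx
    nlinarith [this.1, this.2]
  obtain ⟨D, hD⟩ := isCompact_Icc.exists_bound_of_continuousOn hic
  set C := D + 2 * ρ * exp M with hC
  have hmono : MonotoneOn (fun t => (u t ^ 2 + G t ^ 2) * exp (C * t)) (Icc s c) := by
    refine monotoneOn_of_deriv_nonneg (convex_Icc s c) (by fun_prop) ?_ ?_
    · rw [interior_Icc]
      intro t ht
      have ht' := hsub t (Ioo_subset_Icc_self ht)
      have h1 := (h.hu t ht').differentiableAt
      have h2 := (h.hG t ht').differentiableAt
      exact DifferentiableAt.differentiableWithinAt (by fun_prop)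
    · rw [interior_Icc]
      intro t ht
      have ht' := hsub t (Ioo_subset_Icc_self ht)
      have h1 := h.hu t ht'
      have h2 := h.hG t ht'
      have h3 : HasDerivAt (fun t => exp (C * t)) (exp (C * t) * C) t := by
        simpa using ((hasDerivAt_id' t).const_mul C).exp
      have hd := ((h1.pow 2).add (h2.pow 2)).mul h3
      have hd' := hd.deriv
      simp only [Pi.mul_def, Pi.add_def, Pi.pow_def] at hd'
      rw [hd']
      have bM := hM t (Ioo_subset_Icc_self ht)
      have bD := hD t (Ioo_subset_Icc_self ht)
      rw [Real.norm_eq_abs] at bM bD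
      have hM0 : 0 ≤ M := (abs_nonneg _).trans bM
      have hkey : |exp (u t) - 1| ≤ exp M * |u t| := by
        have i1 := add_one_le_exp (u t)
        have i2 := add_one_le_exp (-(u t))
        have i3 : exp (u t) * exp (-(u t)) = 1 := by rw [← exp_add]; simp
        have i4 : exp (u t) ≤ exp M := exp_le_exp.2 ((le_abs_self _).trans bM)
        have i5 : 1 ≤ exp M := one_le_exp hM0
        have i6 := exp_pos (u t)
        rcases le_total 0 (u t) with hh | hh
        · rw [abs_of_nonneg hh, abs_of_nonneg (by linarith)]
          nlinarith
        · rw [abs_of_nonpos hh, abs_of_nonpos (by linarith [exp_le_one_iff.2 hh])]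
          nlinarith
      have ha := abs_nonneg (u t)
      have hb := abs_nonneg (G t)
      have hab : 2 * (|u t| * |G t|) ≤ u t ^ 2 + G t ^ 2 := by
        nlinarith [sq_nonneg (|u t| - |G t|), sq_abs (u t), sq_abs (G t)]
      have hD0 : 0 ≤ D := (abs_nonneg _).trans bD
      have T1 : -(D * (|u t| * |G t|)) ≤ u t * G t * (1 / (1 - t ^ 2)) := by
        have : |u t * G t * (1 / (1 - t ^ 2))| ≤ D * (|u t| * |G t|) := by
          rw [abs_mul, abs_mul, mul_comm]
          exact mul_le_mul_of_nonneg_right bD (by positivity)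
        exact (abs_le.1 this).1
      have T2 : G t * (exp (u t) - 1) ≤ exp M * (|u t| * |G t|) := by
        have : |G t * (exp (u t) - 1)| ≤ exp M * (|u t| * |G t|) := by
          rw [abs_mul]
          calc |G t| * |exp (u t) - 1| ≤ |G t| * (exp M * |u t|) :=
                mul_le_mul_of_nonneg_left hkey hb
            _ = _ := by ring
        exact (abs_le.1 this).2
      have T3 := mul_le_mul_of_nonneg_left T2 (by linarith : 0 ≤ 4 * ρ)
      have T4 := mul_le_mul_of_nonneg_left hab (by positivity : 0 ≤ C)
      have : 0 ≤ 2 * (u t * G t * (1 / (1 - t ^ 2))) - 4 * ρ * (G t * (exp (u t) - 1))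
          + C * (u t ^ 2 + G t ^ 2) := by
        rw [hC] at T4 ⊢
        nlinarith
      have hfin := mul_nonneg this (exp_pos (C * t)).le
      refine hfin.trans_eq ?_
      simp only [Nat.cast_ofNat]
      ring
  have := hmono (left_mem_Icc.2 hsc) (right_mem_Icc.2 hsc) hsc
  simp only [hu0, hG0] at this
  have e := exp_pos (C * s)
  have : u s ^ 2 + G s ^ 2 ≤ 0 := by
    by_contra hh
    push Not at hh
    have := mul_pos hh e
    norm_num at *
    linarith
  nlinarith [sq_nonneg (u s), sq_nonneg (G s)]

theorem AxSysB.zero_of_nonneg {ρ : ℝ} {u G : ℝ → ℝ} (h : AxSysB ρ u G) (hρ1 : 1 < ρ) (hρ2 : ρ ≤ 2)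
    {t₀ : ℝ} (h0 : 0 ≤ t₀) (h1 : t₀ < 1) (hG0 : G t₀ = 0) : ∀ t ∈ Ioo (-1:ℝ) 1, u t = 0 := by
  have hz := h.zero_right hρ1 hρ2 h0 hG0
  have hu : ∀ t ∈ Ioo t₀ 1, u t = 0 := by
    intro t ht
    have hd := h.hG t ⟨by linarith [ht.1], ht.2⟩
    have hd2 : HasDerivAt G 0 t := by
      refine (hasDerivAt_const t (0:ℝ)).congr_of_eventuallyEq ?_
      filter_upwards [Ioo_mem_nhds ht.1 ht.2] with x hx
      exact hz x (Ioo_subset_Icc_self hx)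
    have := hd.unique hd2
    have h3 : exp (u t) = 1 := by
      rcases mul_eq_zero.1 this with h' | h'
      · linarith
      · linarith
    exact (exp_eq_one_iff _).1 h3
  intro t ht
  rcases lt_or_ge t₀ t with h' | h'
  · exact hu t ⟨h', ht.2⟩
  · have hm : (t₀ + 1) / 2 ∈ Ioo t₀ 1 := ⟨by linarith, by linarith⟩
    exact h.toAxSys.unique_left (by linarith) ht.1 (by linarith [hm.1]) hm.2 (hu _ hm)
      (hz _ (Ioo_subset_Icc_self hm))

theorem AxSysB.exists_zero {ρ : ℝ} {u G : ℝ → ℝ} (h : AxSysB ρ u G) (hρ1 : 1 < ρ) :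
    ∃ t ∈ Ioo (-1:ℝ) 1, G t = 0 := by
  set J : ℝ → ℝ := fun t => G t ^ 2 / 2 + 2 * ρ * (1 - t ^ 2) * (exp (u t) - 1) - 2 * t * G t
    with hJ
  have huc := h.uc
  have hGc := h.Gc
  have hJc : ContinuousOn J (Icc (-1) 1) := by
    simp only [hJ]
    fun_prop
  obtain ⟨c, hc, hc0⟩ := exists_hasDerivAt_eq_zero (f := J) (f' := fun t => 2 * (ρ - 1) * G t)
    (by norm_num : (-1:ℝ) < 1) hJc (by simp [hJ, h.G1, h.Gm1]) (by
      intro t ht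
      have h1 := h.hu t ht
      have h2 := h.hG t ht
      have hid := hasDerivAt_id' t
      have e1 := ((hid.pow 2).const_sub 1).const_mul (2 * ρ)
      have e := (((h2.pow 2).div_const 2).add (e1.mul (h1.exp.sub_const 1))).sub
        ((hid.const_mul 2).mul h2)
      refine e.congr_deriv ?_
      have p : 1 - t ^ 2 ≠ 0 := by nlinarith [ht.1, ht.2]
      simp only [Pi.pow_apply, Nat.cast_ofNat]
      field_simp
      ring)
  refine ⟨c, hc, ?_⟩
  rcases mul_eq_zero.1 hc0 with hz | hz
  · linarith
  · exact hz

/-- Theorem A (axially symmetric case, ODE form): for `1 < ρ ≤ 2`, the only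
function `u`, continuous on `[-1,1]` and `C²` on `(-1,1)`, satisfying
`((1-t²) u')' + 2ρ (e^u - 1) = 0` on `(-1,1)`, is `u ≡ 0`. -/
theorem axially_symmetric_uniqueness (ρ : ℝ) (hρ1 : 1 < ρ) (hρ2 : ρ ≤ 2)
    (u : ℝ → ℝ)
    (hcont : ContinuousOn u (Set.Icc (-1) 1))
    (hC2 : ContDiffOn ℝ 2 u (Set.Ioo (-1) 1))
    (hode : ∀ t ∈ Set.Ioo (-1 : ℝ) 1,
      deriv (fun s => (1 - s ^ 2) * deriv u s) t + 2 * ρ * (Real.exp (u t) - 1) = 0) :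
    ∀ t ∈ Set.Icc (-1 : ℝ) 1, u t = 0 := by
  have hdd : ContDiffOn ℝ 1 (deriv u) (Ioo (-1) 1) :=
    hC2.deriv_of_isOpen isOpen_Ioo (by norm_num)
  set G : ℝ → ℝ := fun s => (1 - s ^ 2) * deriv u s with hGdef
  have hS : AxSys ρ u G := by
    refine ⟨fun t ht => ?_, fun t ht => ?_, hcont⟩
    · have hd := ((hC2.differentiableOn (by norm_num)).differentiableAt
        (isOpen_Ioo.mem_nhds ht)).hasDerivAt
      refine hd.congr_deriv ?_
      have p : 1 - t ^ 2 ≠ 0 := by nlinarith [ht.1, ht.2]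
      simp only [hGdef]
      field_simp
    · have hd1 := (hdd.differentiableOn (by norm_num)).differentiableAt (isOpen_Ioo.mem_nhds ht)
      have hd : DifferentiableAt ℝ G t := by
        simp only [hGdef]
        fun_prop
      refine hd.hasDerivAt.congr_deriv ?_
      linarith [hode t ht]
  have hG1 : G 1 = 0 := by simp [hGdef]
  have hGm1 : G (-1) = 0 := by simp [hGdef]
  have hS2 : AxSysB ρ u G := by
    refine ⟨hS, ?_, hG1, hGm1⟩
    have hin : ∀ t ∈ Ioo (-1:ℝ) 1, ContinuousAt G t := fun t ht => (hS.hG t ht).continuousAt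
    have r1 := hS.tendsto_right
    have r2 : Filter.Tendsto G (nhdsWithin (-1) (Ioi (-1))) (nhds 0) := by
      have := hS.reflect.tendsto_right.neg.comp (tendsto_neg_nhdsGT (a := (-1:ℝ)) |>.mono_right (by simp))
      simpa [Function.comp_def] using this
    intro t ht
    rcases ht.1.eq_or_lt with h' | h'
    · subst h'
      have : ContinuousWithinAt G (Ioi (-1)) (-1) := by
        unfold ContinuousWithinAt; rw [hGm1]; exact r2
      exact (continuousWithinAt_Ioi_iff_Ici.1 this).mono Icc_subset_Ici_self
    · rcases ht.2.eq_or_lt with h'' | h''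
      · subst h''
        have : ContinuousWithinAt G (Iio 1) 1 := by
          unfold ContinuousWithinAt; rw [hG1]; exact r1
        exact (continuousWithinAt_Iio_iff_Iic.1 this).mono Icc_subset_Iic_self
      · exact (hin t ⟨h', h''⟩).continuousWithinAt
  have hmain : ∀ t ∈ Ioo (-1:ℝ) 1, u t = 0 := by
    obtain ⟨c, hc, hc0⟩ := hS2.exists_zero hρ1
    rcases le_total 0 c with h' | h'
    · exact hS2.zero_of_nonneg hρ1 hρ2 h' hc.2 hc0
    · intro t ht
      have := hS2.reflect.zero_of_nonneg hρ1 hρ2 (t₀ := -c) (by linarith) (by linarith [hc.1])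
        (by simp [hc0]) (-t) ⟨by linarith [ht.2], by linarith [ht.1]⟩
      simpa using this
  have hcl : EqOn u (fun _ => 0) (closure (Ioo (-1:ℝ) 1)) := by
    refine EqOn.of_subset_closure (s := Ioo (-1:ℝ) 1) (t := closure (Ioo (-1:ℝ) 1))
      (fun t ht => hmain t ht) ?_ continuousOn_const subset_closure le_rfl
    rwa [closure_Ioo (by norm_num)]
  rw [closure_Ioo (by norm_num)] at hcl
  exact hcl
end

section
/- (One-dimensional Onofri–Aubin inequality) Let g : (−1,1) → ℝ be continuously differentiable with ∫_{−1}^{1} (1−x²) |g'(x)|² dx < ∞, with x ↦ e^{2g(x)} integrable on (−1,1), and satisfying the constraint ∫_{−1}^{1} e^{2g(x)} x dx = 0. Then (1/2) ∫_{−1}^{1} (1−x²) |g'(x)|² dx + 2 ∫_{−1}^{1} g(x) dx − 2 ln( (1/2) ∫_{−1}^{1} e^{2g(x)} dx ) ≥ 0. -/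
open MeasureTheory Real Set

/-- Rational identity behind the pointwise calibration. -/
lemma oa_rational (b y r : ℝ) (hb1 : -1 < b) (hby : b < y) (hy : y < 1) :
    2 * (r - y) ^ 2 / (1 - y ^ 2) + 4 * r * b / (1 - b * y) + 2
      - 2 * ((1 - b ^ 2) / (1 - b * y) ^ 2)
      - ((1 - b ^ 2) / (1 - b * y) ^ 2) * (r - (y - b) / (1 - b * y)) ^ 2
        / (((y - b) / (1 - b * y)) * (((1 - y) * (1 + b)) / (1 - b * y))) ≤ 0 := by
  have h1 : 0 < 1 - y := by linarith
  have h2 : 0 < 1 + y := by linarith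
  have h3 : 0 < 1 - b := by linarith
  have h4 : 0 < 1 + b := by linarith
  have h5 : 0 < y - b := by linarith
  have hw : 0 < 1 - b * y := by nlinarith
  have e1 : 1 - y ^ 2 = (1 - y) * (1 + y) := by ring
  have key : 2 * (r - y) ^ 2 / (1 - y ^ 2) + 4 * r * b / (1 - b * y) + 2
      - 2 * ((1 - b ^ 2) / (1 - b * y) ^ 2)
      - ((1 - b ^ 2) / (1 - b * y) ^ 2) * (r - (y - b) / (1 - b * y)) ^ 2
        / (((y - b) / (1 - b * y)) * (((1 - y) * (1 + b)) / (1 - b * y)))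
      = - ((1 + b) * (r - (y - b) / (1 - b * y)) ^ 2 / ((y - b) * (1 + y))) := by
    rw [e1]
    obtain ⟨w, hwe⟩ : ∃ w, w = 1 - b * y := ⟨_, rfl⟩
    rw [← hwe] at hw ⊢
    field_simp
    rw [hwe]
    ring
  rw [key]
  have : 0 ≤ ((1 + b) * (r - (y - b) / (1 - b * y)) ^ 2 / ((y - b) * (1 + y))) := by positivity
  linarith

/-- Concavity of the logarithm. -/
lemma oa_concave (b y : ℝ) (hb1 : -1 < b) (hb2 : b < 1) (hy1 : -1 < y) (hy : y < 1) :
    (log (1 - b) + log (1 + b)) / 2 - log (1 - b * y)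
      ≤ (log (1 + b) - log (1 - b)) / 2 * y := by
  have hc : ConcaveOn ℝ (Ioi 0) log := strictConcaveOn_log_Ioi.concaveOn
  have m1 : (1 - b) ∈ Ioi (0 : ℝ) := by show (0:ℝ) < 1 - b; linarith
  have m2 : (1 + b) ∈ Ioi (0 : ℝ) := by show (0:ℝ) < 1 + b; linarith
  have n1 : 0 ≤ (1 + y) / 2 := by linarith
  have n2 : 0 ≤ (1 - y) / 2 := by linarith
  have h := hc.2 m1 m2 n1 n2 (by ring)
  simp only [smul_eq_mul] at h
  have e : (1 + y) / 2 * (1 - b) + (1 - y) / 2 * (1 + b) = 1 - b * y := by ring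
  rw [e] at h
  nlinarith

lemma oa_pointwise (b y r p q g N : ℝ) (hb1 : -1 < b) (hby : b < y) (hy : y < 1)
    (hr0 : 0 < r) (hr1 : r < 1) (hN : 0 < N) (hp : p = N * exp (2 * g)) :
    -2 * (q * (r - y) + g * (p - 1))
      + 4 * (p * ((log (1 - b) + log (1 + b)) / 2 - log (1 - b * y)) + r * (b / (1 - b * y)))
      + 2 * (1 - (1 - b ^ 2) / (1 - b * y) ^ 2)
      + p * (log r + 1)
      - (p * (log (y - b) - log (1 - b * y)) + r * (1 / (y - b) + b / (1 - b * y)))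
      + p * (log (1 - r) + 1)
      + (-p * (log (1 - y) + log (1 + b) - log (1 - b * y))
          + (1 - r) * (- 1 / (1 - y) + b / (1 - b * y)))
      + ((1 - b ^ 2) / (1 - b * y) ^ 2 - p)
    ≤ 1 / 2 * ((1 - y ^ 2) * q ^ 2) + 2 * g + log N * (N * exp (2 * g))
      + 2 * ((log (1 + b) - log (1 - b)) / 2) * (N * exp (2 * g) * y) := by
  have h1 : 0 < 1 - y := by linarith
  have h2 : 0 < 1 + y := by linarith
  have h3 : 0 < 1 - b := by linarith
  have h4 : 0 < 1 + b := by linarith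
  have h5 : 0 < y - b := by linarith
  have hw : 0 < 1 - b * y := by nlinarith
  have hr' : 0 < 1 - r := by linarith
  have hp0 : 0 < p := by rw [hp]; positivity
  rw [← hp]
  have hlogp : log p = log N + 2 * g := by
    rw [hp, log_mul hN.ne' (exp_pos _).ne', log_exp]
  have hrat := oa_rational b y r hb1 hby hy
  have hconc := mul_le_mul_of_nonneg_left
    (oa_concave b y hb1 (by linarith) (by linarith) hy) hp0.le
  have hy2 : 0 < 1 - y ^ 2 := by nlinarith
  have hyoung : -2 * (q * (r - y)) ≤ 1 / 2 * ((1 - y ^ 2) * q ^ 2)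
      + 2 * (r - y) ^ 2 / (1 - y ^ 2) := by
    have : 1 / 2 * ((1 - y ^ 2) * q ^ 2) + 2 * (r - y) ^ 2 / (1 - y ^ 2) + 2 * (q * (r - y))
       = ((1 - y ^ 2) * q + 2 * (r - y)) ^ 2 / (2 * (1 - y ^ 2)) := by
      field_simp; ring
    have h0 : 0 ≤ ((1 - y ^ 2) * q + 2 * (r - y)) ^ 2 / (2 * (1 - y ^ 2)) := by positivity
    linarith
  -- the logarithmic inequality
  have hlog : p * (log r + log (1 - r) + (log (1 - b) + log (1 + b) - 2 * log (1 - b * y))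
       - (log (y - b) - log (1 - b * y)) - (log (1 - y) + log (1 + b) - log (1 - b * y))
       - log p) ≤ ((1 - b) * (1 + b) * r * (1 - r)) / ((y - b) * ((1 - y) * (1 + b))) - p := by
    have hv : 0 < ((1 - b) * (1 + b) * r * (1 - r)) / ((y - b) * ((1 - y) * (1 + b)) * p) := by
      positivity
    have := log_le_sub_one_of_pos hv
    rw [log_div (by positivity) (by positivity), log_mul (by positivity) (by positivity),
      log_mul (by positivity) (by positivity), log_mul (by positivity) (by positivity),
      log_mul (by positivity) (by positivity), log_mul (by positivity) (by positivity),
      log_mul (by positivity) (by positivity)] at this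
    have h := mul_le_mul_of_nonneg_left this hp0.le
    have e : p * (((1 - b) * (1 + b) * r * (1 - r)) / ((y - b) * ((1 - y) * (1 + b)) * p) - 1)
      = ((1 - b) * (1 + b) * r * (1 - r)) / ((y - b) * ((1 - y) * (1 + b))) - p := by
      field_simp
    rw [e] at h
    refine le_trans (le_of_eq ?_) h
    ring
  have hid : 4 * (r * (b / (1 - b * y))) + 2 * (1 - (1 - b ^ 2) / (1 - b * y) ^ 2)
      - r * (1 / (y - b) + b / (1 - b * y)) + (1 - r) * (- 1 / (1 - y) + b / (1 - b * y))
      + (1 - b ^ 2) / (1 - b * y) ^ 2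
      + ((1 - b) * (1 + b) * r * (1 - r)) / ((y - b) * ((1 - y) * (1 + b)))
      = 4 * r * b / (1 - b * y) + 2
      - 2 * ((1 - b ^ 2) / (1 - b * y) ^ 2)
      - ((1 - b ^ 2) / (1 - b * y) ^ 2) * (r - (y - b) / (1 - b * y)) ^ 2
        / (((y - b) / (1 - b * y)) * (((1 - y) * (1 + b)) / (1 - b * y))) := by
    field_simp
    ring
  rw [hlogp] at hlog
  linarith

lemma oa_growth (b : ℝ) (g g' : ℝ → ℝ) (hb1 : -1 < b) (hb2 : b < 1)
    (hg : ∀ x ∈ Ioo (-1 : ℝ) 1, HasDerivAt g (g' x) x)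
    (hint : IntegrableOn (fun x => (1 - x ^ 2) * (g' x) ^ 2) (Ioo (-1) 1)) :
    ∃ C, ∀ x ∈ Ico b 1, g x ≤ C - 1 / 4 * log (1 - x) := by
  refine ⟨(g b + 1 / 4 * log (1 - b)) +
    ∫ x in Ioo (-1 : ℝ) 1, (1 - x ^ 2) * (g' x) ^ 2 / (1 + b), fun x hx => ?_⟩
  have hint' : IntegrableOn (fun x => (1 - x ^ 2) * (g' x) ^ 2 / (1 + b)) (Ioo (-1) 1) :=
    hint.div_const (1 + b)
  have hd : ∀ y ∈ Icc b x, HasDerivAt (fun y => g y + 1 / 4 * log (1 - y))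
      (g' y + 1 / 4 * (-1 / (1 - y))) y := by
    intro y hy
    have : 0 < 1 - y := by linarith [hy.2, hx.2]
    exact (hg y ⟨by linarith [hy.1], by linarith⟩).add
      ((((hasDerivAt_id y).const_sub 1).log this.ne').const_mul _)
  have hsub : Icc b x ⊆ Ioo (-1 : ℝ) 1 := fun y hy => ⟨by linarith [hy.1], by linarith [hy.2, hx.2]⟩
  have h := intervalIntegral.sub_le_integral_of_hasDeriv_right_of_le (a := b) (b := x)
    (g := fun y => g y + 1 / 4 * log (1 - y)) (g' := fun y => g' y + 1 / 4 * (-1 / (1 - y)))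
    (φ := fun x => (1 - x ^ 2) * (g' x) ^ 2 / (1 + b)) hx.1
    (fun y hy => (hd y hy).continuousAt.continuousWithinAt)
    (fun y hy => (hd y ⟨hy.1.le, hy.2.le⟩).hasDerivWithinAt)
    (hint'.mono_set hsub) (fun y hy => by
      have h1 : 0 < 1 - y := by linarith [hy.2, hx.2]
      have h2 : 0 < 1 + b := by linarith
      have h3 : (1 - y) * g' y ^ 2 ≤ (1 - y ^ 2) * g' y ^ 2 / (1 + b) := by
        rw [le_div_iff₀ h2]
        have : 0 ≤ (1 - y) * g' y ^ 2 * (y - b) :=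
          mul_nonneg (by positivity) (by linarith [hy.1])
        linarith
      have h4 : g' y + 1 / 4 * (-1 / (1 - y)) ≤ (1 - y) * g' y ^ 2 := by
        have : (1 - y) * g' y ^ 2 - (g' y + 1 / 4 * (-1 / (1 - y)))
          = ((1 - y) * g' y - 1 / 2) ^ 2 / (1 - y) := by field_simp; ring
        have h0 : 0 ≤ ((1 - y) * g' y - 1 / 2) ^ 2 / (1 - y) := by positivity
        linarith
      exact h4.trans h3)
  have h2 : ∫ y in b..x, (1 - y ^ 2) * (g' y) ^ 2 / (1 + b)
      ≤ ∫ x in Ioo (-1 : ℝ) 1, (1 - x ^ 2) * (g' x) ^ 2 / (1 + b) := by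
    rw [intervalIntegral.integral_of_le hx.1]
    refine setIntegral_mono_set hint' ?_ (Filter.Eventually.of_forall
      (Ioc_subset_Icc_self.trans hsub))
    filter_upwards [ae_restrict_mem measurableSet_Ioo] with y hy
    have h1 : 0 < 1 - y ^ 2 := by nlinarith [hy.1, hy.2]
    have h2 : 0 < 1 + b := by linarith
    show 0 ≤ _
    positivity
  linarith

lemma oa_tail (b N : ℝ) (g r : ℝ → ℝ) (hb1 : -1 < b) (hb2 : b < 1) (hN : 0 < N)
    (hr : ∀ x ∈ Ioo (-1 : ℝ) 1, HasDerivAt r (N * exp (2 * g x)) x)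
    (hrc : ContinuousOn r (Icc b 1)) (hr1 : r 1 = 1)
    (hgr : ∃ C, ∀ x ∈ Ico b 1, g x ≤ C - 1 / 4 * log (1 - x)) :
    ∃ C, 0 ≤ C ∧ ∀ x ∈ Icc b 1, 1 - r x ≤ C * sqrt (1 - x) := by
  obtain ⟨C, hC⟩ := hgr
  refine ⟨2 * (N * exp (2 * C)), by positivity, fun x hx => ?_⟩
  have hanti : AntitoneOn (fun x => r x + 2 * (N * exp (2 * C)) * sqrt (1 - x)) (Icc b 1) := by
    have hD : ∀ y ∈ interior (Icc b 1), HasDerivAt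
        (fun x => r x + 2 * (N * exp (2 * C)) * sqrt (1 - x))
        (N * exp (2 * g y) + 2 * (N * exp (2 * C)) * (-1 / (2 * sqrt (1 - y)))) y := by
      intro y hy
      rw [interior_Icc] at hy
      have : 0 < 1 - y := by linarith [hy.2]
      exact (hr y ⟨by linarith [hy.1], hy.2⟩).add
        ((((hasDerivAt_id y).const_sub 1).sqrt this.ne').const_mul _)
    refine antitoneOn_of_deriv_nonpos (convex_Icc _ _) ?_
      (fun y hy => (hD y hy).differentiableAt.differentiableWithinAt) ?_
    · exact hrc.add (by fun_prop)
    · intro y hy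
      rw [(hD y hy).deriv]
      rw [interior_Icc] at hy
      have h0 : 0 < 1 - y := by linarith [hy.2]
      have hs : 0 < sqrt (1 - y) := sqrt_pos.2 h0
      have h1 := hC y ⟨hy.1.le, hy.2⟩
      have h2 : exp (2 * g y) ≤ exp (2 * C) / sqrt (1 - y) := by
        rw [← exp_log hs, ← exp_sub, log_sqrt h0.le]
        apply exp_le_exp.2
        linarith
      have h3 : 2 * (N * exp (2 * C)) * (-1 / (2 * sqrt (1 - y)))
        = - (N * (exp (2 * C) / sqrt (1 - y))) := by field_simp
      rw [h3]
      nlinarith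
  have h := hanti hx (right_mem_Icc.2 hb2.le) hx.2
  simp only [hr1, sub_self, sqrt_zero, mul_zero, add_zero] at h
  linarith

lemma oa_integrable (b : ℝ) (g : ℝ → ℝ) (hb1 : -1 < b)
    (hgc : ContinuousOn g (Ioo (-1 : ℝ) 1)) 
    (h1 : ∃ C, ∀ x ∈ Ico b 1, g x ≤ C - 1 / 4 * log (1 - x)) 
    (h2 : ∃ C, ∀ x ∈ Ico b 1, -g x ≤ C - 1 / 4 * log (1 - x)) :
    IntegrableOn g (Ioo b 1) := by
  obtain ⟨C, hC⟩ := h1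
  obtain ⟨D, hD⟩ := h2
  have hl : IntervalIntegrable (fun x : ℝ => log (1 - x)) volume b 1 := by
    have := (intervalIntegral.intervalIntegrable_log' (a := 1 - b) (b := 1 - 1)).comp_sub_left 1
    simpa using this
  have hl' : IntegrableOn (fun x : ℝ => log (1 - x)) (Ioo b 1) :=
    hl.1.mono_set Ioo_subset_Ioc_self
  have hi : IntegrableOn (fun x : ℝ => (|C| + |D|) + 1 / 4 * |log (1 - x)|) (Ioo b 1) :=
    (integrableOn_const (by simp)).add (hl'.abs.const_mul _)
  refine Integrable.mono' hi ?_ ?_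
  · exact (hgc.mono (fun x hx => ⟨by linarith [hx.1], hx.2⟩)).aestronglyMeasurable
      measurableSet_Ioo
  · filter_upwards [ae_restrict_mem measurableSet_Ioo] with x hx
    have a1 := hC x ⟨hx.1.le, hx.2⟩
    have a2 := hD x ⟨hx.1.le, hx.2⟩
    have := neg_abs_le (log (1 - x))
    have := le_abs_self C
    have := le_abs_self D
    have := abs_nonneg C
    have := abs_nonneg D
    rw [norm_eq_abs, abs_le]
    constructor <;> linarith

open Filter Topology in
lemma oa_mul_log (f u : ℝ → ℝ) (s : Set ℝ) (x₀ C : ℝ)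
    (hu : ContinuousWithinAt u s x₀) (hu0 : u x₀ = 0) (hx : x₀ ∈ s)
    (hpos : ∀ x ∈ s, 0 ≤ u x)
    (hf : ∀ᶠ x in 𝓝[s] x₀, |f x| ≤ C * sqrt (u x)) :
    ContinuousWithinAt (fun x => f x * log (u x)) s x₀ := by
  have h1 : Tendsto (fun x => C * |2 * (sqrt (u x) * log (sqrt (u x)))|) (𝓝[s] x₀) (𝓝 0) := by
    have hc : ContinuousWithinAt (fun x => C * |2 * (sqrt (u x) * log (sqrt (u x)))|) s x₀ := by
      have h2 : ContinuousWithinAt (fun x => sqrt (u x) * log (sqrt (u x))) s x₀ :=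
        (continuous_mul_log.continuousAt.comp_continuousWithinAt hu.sqrt)
      exact continuousWithinAt_const.mul (continuousWithinAt_const.mul h2).abs
    have := hc.tendsto
    simpa [hu0] using this
  unfold ContinuousWithinAt
  simp only [hu0, log_zero, mul_zero]
  refine squeeze_zero_norm' ?_ h1
  filter_upwards [hf, self_mem_nhdsWithin] with x hx1 hx2
  rw [norm_eq_abs, abs_mul, log_sqrt (hpos x hx2), abs_mul, abs_mul, abs_div,
    abs_of_nonneg (sqrt_nonneg (u x))]
  have := mul_le_mul_of_nonneg_right hx1 (abs_nonneg (log (u x)))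
  have e : C * (|2| * (√(u x) * (|log (u x)| / |2|))) = C * √(u x) * |log (u x)| := by
    norm_num
    ring
  rw [e]
  exact this

open Filter Topology in
lemma oa_half (b N : ℝ) (g g' r : ℝ → ℝ) (hb1 : -1 < b) (hb2 : b < 1) (hN : 0 < N)
    (hg : ∀ x ∈ Ioo (-1 : ℝ) 1, HasDerivAt g (g' x) x)
    (hint : IntegrableOn (fun x => (1 - x ^ 2) * (g' x) ^ 2) (Ioo (-1) 1))
    (hexp : IntegrableOn (fun x => exp (2 * g x)) (Ioo (-1) 1))
    (hr : ∀ x ∈ Ioo (-1 : ℝ) 1, HasDerivAt r (N * exp (2 * g x)) x)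
    (hrc : ContinuousOn r (Icc b 1)) (hrb : r b = 0) (hr1 : r 1 = 1) :
    IntegrableOn g (Ioo b 1) ∧
    2 * (log (1 + b) - log (1 - b)) - 2 * b * g b - 2 * b ≤
      ∫ x in b..1, (1 / 2 * ((1 - x ^ 2) * (g' x) ^ 2) + 2 * g x
        + log N * (N * exp (2 * g x))
        + 2 * ((log (1 + b) - log (1 - b)) / 2) * (N * exp (2 * g x) * x)) := by
  have hG1 := oa_growth b g g' hb1 hb2 hg hint
  have hG2 := oa_growth b (fun x => - g x) (fun x => - g' x) hb1 hb2 (fun x hx => (hg x hx).neg)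
    (by simpa using hint)
  have hgc : ContinuousOn g (Ioo (-1 : ℝ) 1) :=
    fun x hx => (hg x hx).continuousAt.continuousWithinAt
  have hgi := oa_integrable b g hb1 hgc hG1 hG2
  refine ⟨hgi, ?_⟩
  obtain ⟨K, hK0, hK⟩ := oa_tail b N g r hb1 hb2 hN hr hrc hr1 hG1
  have hmono : StrictMonoOn r (Icc b 1) := by
    refine strictMonoOn_of_deriv_pos (convex_Icc _ _) hrc fun x hx => ?_
    rw [interior_Icc] at hx
    rw [(hr x ⟨by linarith [hx.1], hx.2⟩).deriv]
    positivity
  have hrle : ∀ x ∈ Icc b 1, r x ≤ 1 := fun x hx => by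
    rw [← hr1]; exact hmono.monotoneOn hx (right_mem_Icc.2 hb2.le) hx.2
  have hw : ∀ x ∈ Icc b 1, 0 < 1 - b * x := fun x hx => by nlinarith [hx.1, hx.2]
  -- continuity of the singular pieces
  have hlw : ContinuousOn (fun x => log (1 - b * x)) (Icc b 1) :=
    ContinuousOn.log (by fun_prop) (fun x hx => (hw x hx).ne')
  have c1 : ContinuousOn (fun x => r x * log (x - b)) (Icc b 1) := by
    intro x hx
    rcases hx.1.eq_or_lt with h | h
    · subst h
      have hbig := (hr b ⟨hb1, hb2⟩).isBigO_sub
      obtain ⟨C, hC⟩ := hbig.bound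
      refine oa_mul_log r (fun x => x - b) _ b (|C|) (by fun_prop) (by simp) hx
        (fun x hx => by linarith [hx.1]) ?_
      have hlt : ∀ᶠ x in 𝓝[Icc b 1] b, x < b + 1 :=
        nhdsWithin_le_nhds (Iio_mem_nhds (by linarith))
      filter_upwards [nhdsWithin_le_nhds hC, hlt, self_mem_nhdsWithin] with x h1 h2 h3
      rw [hrb, sub_zero, norm_eq_abs, norm_eq_abs] at h1
      have h0 : 0 ≤ x - b := by linarith [h3.1]
      have hs : x - b ≤ sqrt (x - b) := by
        apply le_sqrt_of_sq_le
        nlinarith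
      calc |r x| ≤ C * |x - b| := h1
        _ ≤ |C| * |x - b| := mul_le_mul_of_nonneg_right (le_abs_self C) (abs_nonneg _)
        _ ≤ |C| * sqrt (x - b) := by
          rw [abs_of_nonneg h0]; exact mul_le_mul_of_nonneg_left hs (abs_nonneg _)
    · exact (hrc x hx).mul (ContinuousWithinAt.log (by fun_prop) (by linarith))
  have c2 : ContinuousOn (fun x => (1 - r x) * log (1 - x)) (Icc b 1) := by
    intro x hx
    rcases hx.2.eq_or_lt with h | h
    · subst h
      refine oa_mul_log (fun x => 1 - r x) (fun y => 1 - y) _ 1 K (by fun_prop) (by simp) hx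
        (fun x hx => by linarith [hx.2]) ?_
      filter_upwards [self_mem_nhdsWithin] with y hy
      rw [abs_of_nonneg (by linarith [hrle y hy])]
      exact hK y hy
    · exact (continuousWithinAt_const.sub (hrc x hx)).mul
        (ContinuousWithinAt.log (by fun_prop) (by linarith))
  have c3 : ContinuousOn (fun x => g x * (r x - x)) (Icc b 1) := by
    intro x hx
    rcases hx.2.eq_or_lt with h | h
    · subst h
      have hl : ContinuousWithinAt (fun y => (r y - y) * log (1 - y)) (Icc b 1) 1 := by
        refine oa_mul_log (fun y => r y - y) (fun y => 1 - y) _ 1 (K + 2) (by fun_prop) (by simp)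
          hx (fun x hx => by linarith [hx.2]) ?_
        filter_upwards [self_mem_nhdsWithin] with y hy
        have a1 := hrle y hy
        have a2 := hK y hy
        have a3 : 0 ≤ 1 - y := by linarith [hy.2]
        have a4 : 1 - y ≤ 2 * sqrt (1 - y) := by
          have := sq_sqrt a3
          have : sqrt (1 - y) ≤ 2 := by
            rw [sqrt_le_left (by norm_num)]; linarith [hy.1]
          nlinarith [sqrt_nonneg (1 - y)]
        have a5 := mul_nonneg hK0 (sqrt_nonneg (1 - y))
        rw [abs_le]
        constructor <;> nlinarith [sqrt_nonneg (1 - y)]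
      have hd : ContinuousWithinAt (fun y => r y - y) (Icc b 1) 1 :=
        (hrc 1 hx).sub continuousWithinAt_id
      obtain ⟨C, hC⟩ := hG1
      obtain ⟨D, hD⟩ := hG2
      have hlim : Tendsto (fun y => (|C| + |D|) * |r y - y| + 1 / 4 * |(r y - y) * log (1 - y)|)
          (𝓝[Icc b 1] 1) (𝓝 0) := by
        have hcc : ContinuousWithinAt (fun y => (|C| + |D|) * |r y - y|
            + 1 / 4 * |(r y - y) * log (1 - y)|) (Icc b 1) 1 :=
          (continuousWithinAt_const.mul hd.abs).add (continuousWithinAt_const.mul hl.abs)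
        simpa [hr1] using hcc.tendsto
      unfold ContinuousWithinAt
      simp only [hr1, sub_self, mul_zero]
      refine squeeze_zero_norm' ?_ hlim
      filter_upwards [self_mem_nhdsWithin] with y hy
      rcases hy.2.eq_or_lt with h | h
      · subst h; simp [hr1]
      · have b1 := hC y ⟨hy.1, h⟩
        have b2 := hD y ⟨hy.1, h⟩
        have : |g y| ≤ (|C| + |D|) + 1 / 4 * |log (1 - y)| := by
          have := neg_abs_le (log (1 - y))
          have := le_abs_self C
          have := le_abs_self D
          have := abs_nonneg C
          have := abs_nonneg D
          rw [abs_le]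
          constructor <;> linarith
        rw [norm_eq_abs, abs_mul, abs_mul]
        have := mul_le_mul_of_nonneg_right this (abs_nonneg (r y - y))
        linarith
    · exact (hg x ⟨by linarith [hx.1], h⟩).continuousAt.continuousWithinAt.mul
        ((hrc x hx).sub continuousWithinAt_id)
  let B : ℝ → ℝ := fun x => -2 * (g x * (r x - x))
      + 4 * (r x * ((log (1 - b) + log (1 + b)) / 2 - log (1 - b * x)))
      + 2 * (x - (x - b) / (1 - b * x))
      + r x * log (r x)
      - r x * (log (x - b) - log (1 - b * x))
      - (1 - r x) * log (1 - r x)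
      + (1 - r x) * (log (1 - x) + log (1 + b) - log (1 - b * x))
      + ((x - b) / (1 - b * x) - r x)
  have hBc : ContinuousOn B (Icc b 1) := by
    have hz : ContinuousOn (fun x => (x - b) / (1 - b * x)) (Icc b 1) :=
      ContinuousOn.div (by fun_prop) (by fun_prop) (fun x hx => (hw x hx).ne')
    have c4 : ContinuousOn (fun x => r x * log (r x)) (Icc b 1) :=
      continuous_mul_log.comp_continuousOn hrc
    have hr' : ContinuousOn (fun x => 1 - r x) (Icc b 1) := continuousOn_const.sub hrc
    have c5 : ContinuousOn (fun x => (1 - r x) * log (1 - r x)) (Icc b 1) :=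
      continuous_mul_log.comp_continuousOn hr'
    have c6 : ContinuousOn (fun x => r x * (log (x - b) - log (1 - b * x))) (Icc b 1) := by
      simp only [mul_sub]
      exact c1.sub (hrc.mul hlw)
    have c7 : ContinuousOn (fun x => (1 - r x) * (log (1 - x) + log (1 + b) - log (1 - b * x)))
        (Icc b 1) := by
      have : ContinuousOn (fun x => (1 - r x) * log (1 - x)
        + (1 - r x) * (log (1 + b) - log (1 - b * x))) (Icc b 1) :=
        c2.add (hr'.mul (continuousOn_const.sub hlw))
      refine this.congr fun x _ => ?_
      ring
    have c8 : ContinuousOn (fun x => r x * ((log (1 - b) + log (1 + b)) / 2 - log (1 - b * x)))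
        (Icc b 1) := hrc.mul (continuousOn_const.sub hlw)
    exact (((((((continuousOn_const.mul c3).add (continuousOn_const.mul c8)).add
      (continuousOn_const.mul (continuousOn_id.sub hz))).add c4).sub c6).sub c5).add c7).add
      (hz.sub hrc)
  have hsub : Ioo b 1 ⊆ Ioo (-1 : ℝ) 1 := fun x hx => ⟨by linarith [hx.1], hx.2⟩
  have hφ : IntegrableOn (fun x => (1 / 2 * ((1 - x ^ 2) * (g' x) ^ 2) + 2 * g x
        + log N * (N * exp (2 * g x))
        + 2 * ((log (1 + b) - log (1 - b)) / 2) * (N * exp (2 * g x) * x))) (Icc b 1) := by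
    rw [integrableOn_Icc_iff_integrableOn_Ioo]
    have he := hexp.mono_set hsub
    have hex : IntegrableOn (fun x => N * exp (2 * g x) * x) (Ioo b 1) := by
      refine (he.const_mul N).mul_bdd (c := 1) (by fun_prop) ?_
      filter_upwards [ae_restrict_mem measurableSet_Ioo] with x hx
      rw [norm_eq_abs, abs_le]
      constructor <;> linarith [hx.1, hx.2]
    exact ((((hint.mono_set hsub).const_mul _).add (hgi.const_mul _)).add
      ((he.const_mul _).const_mul _)).add (hex.const_mul _)
  have hmain := intervalIntegral.sub_le_integral_of_hasDeriv_right_of_le (a := b) (b := 1)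
    (g := B) (g' := fun y => -2 * (g' y * (r y - y) + g y * (N * exp (2 * g y) - 1))
      + 4 * (N * exp (2 * g y) * ((log (1 - b) + log (1 + b)) / 2 - log (1 - b * y))
          + r y * (b / (1 - b * y)))
      + 2 * (1 - (1 - b ^ 2) / (1 - b * y) ^ 2)
      + N * exp (2 * g y) * (log (r y) + 1)
      - (N * exp (2 * g y) * (log (y - b) - log (1 - b * y))
          + r y * (1 / (y - b) + b / (1 - b * y)))
      + N * exp (2 * g y) * (log (1 - r y) + 1)
      + (-(N * exp (2 * g y)) * (log (1 - y) + log (1 + b) - log (1 - b * y))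
          + (1 - r y) * (- 1 / (1 - y) + b / (1 - b * y)))
      + ((1 - b ^ 2) / (1 - b * y) ^ 2 - N * exp (2 * g y))) hb2.le hBc ?_ hφ ?_
  · have hB1 : B 1 = 2 * (log (1 + b) - log (1 - b)) := by
      have : (1 - b) / (1 - b * 1) = 1 := by
        rw [mul_one]; exact div_self (by linarith)
      simp only [B, hr1, this]
      simp
      ring
    have hB0 : B b = 2 * b * g b + 2 * b := by
      simp [B, hrb]
      have : log (1 - b * b) = log (1 + b) + log (1 - b) := by
        rw [← log_mul (by linarith) (by linarith)]; ring_nf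
      rw [this]
      ring
    rw [hB1, hB0] at hmain
    linarith
  · intro y hy
    have hyI : y ∈ Icc b 1 := ⟨hy.1.le, hy.2.le⟩
    have hr0 : 0 < r y := by rw [← hrb]; exact hmono (left_mem_Icc.2 hb2.le) hyI hy.1
    have hr1' : r y < 1 := by rw [← hr1]; exact hmono hyI (right_mem_Icc.2 hb2.le) hy.2
    have hwy := hw y hyI
    have dr := hr y (hsub hy)
    have dg := hg y (hsub hy)
    have dw : HasDerivAt (fun x => 1 - b * x) (-b) y := by
      simpa using ((hasDerivAt_id y).const_mul b).const_sub 1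
    have dlw := dw.log hwy.ne'
    have dz : HasDerivAt (fun x => (x - b) / (1 - b * x))
        ((1 - b ^ 2) / (1 - b * y) ^ 2) y := by
      have := ((hasDerivAt_id y).sub_const b).div dw hwy.ne'
      refine this.congr_deriv ?_
      simp only [id]
      congr 1
      ring
    have dlb : HasDerivAt (fun x => log (x - b)) (1 / (y - b)) y :=
      ((hasDerivAt_id y).sub_const b).log (by simp only [id]; linarith [hy.1])
    have dl1 : HasDerivAt (fun x => log (1 - x)) (-1 / (1 - y)) y :=
      ((hasDerivAt_id y).const_sub 1).log (by simp only [id]; linarith [hy.2])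
    have dr' := dr.const_sub 1
    have dlr := dr.log hr0.ne'
    have dlr' := dr'.log (by linarith : (1 - r y) ≠ 0)
    have hB : HasDerivAt B _ y :=
      ((((((((dg.mul (dr.sub (hasDerivAt_id y))).const_mul (-2)).add
      ((dr.mul (dlw.const_sub ((log (1 - b) + log (1 + b)) / 2))).const_mul 4)).add
      (((hasDerivAt_id y).sub dz).const_mul 2)).add (dr.mul dlr)).sub
      (dr.mul (dlb.sub dlw))).sub (dr'.mul dlr')).add
      (dr'.mul ((dl1.add_const (log (1 + b))).sub dlw))).add (dz.sub dr)
    refine (hB.congr_deriv ?_).hasDerivWithinAt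
    have e1 : r y * (N * exp (2 * g y) / r y) = N * exp (2 * g y) := by field_simp
    have e2 : (1 - r y) * (-(N * exp (2 * g y)) / (1 - r y)) = -(N * exp (2 * g y)) := by
      have : 1 - r y ≠ 0 := by linarith
      field_simp
    simp only [e1, e2, id, Pi.sub_apply]
    ring
  · intro y hy
    have hyI : y ∈ Icc b 1 := ⟨hy.1.le, hy.2.le⟩
    have hr0 : 0 < r y := by rw [← hrb]; exact hmono (left_mem_Icc.2 hb2.le) hyI hy.1
    have hr1' : r y < 1 := by rw [← hr1]; exact hmono hyI (right_mem_Icc.2 hb2.le) hy.2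
    exact oa_pointwise b y (r y) (N * exp (2 * g y)) (g' y) (g y) N hb1 hy.1 hy.2 hr0 hr1' hN rfl

theorem one_dimensional_onofri_aubin (g : ℝ → ℝ)
    (hg : ContDiffOn ℝ 1 g (Set.Ioo (-1) 1))
    (hdir : IntegrableOn (fun x => (1 - x ^ 2) * (deriv g x) ^ 2) (Set.Ioo (-1) 1))
    (hexp : IntegrableOn (fun x => Real.exp (2 * g x)) (Set.Ioo (-1) 1))
    (hconstraint : ∫ x in Set.Ioo (-1 : ℝ) 1, Real.exp (2 * g x) * x = 0) :
    (1 / 2) * (∫ x in Set.Ioo (-1 : ℝ) 1, (1 - x ^ 2) * (deriv g x) ^ 2)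
      + 2 * (∫ x in Set.Ioo (-1 : ℝ) 1, g x)
      - 2 * Real.log ((1 / 2) * ∫ x in Set.Ioo (-1 : ℝ) 1, Real.exp (2 * g x)) ≥ 0 := by
  have hd : ∀ x ∈ Ioo (-1 : ℝ) 1, HasDerivAt g (deriv g x) x := fun x hx =>
    ((hg.differentiableOn (by norm_num)).differentiableAt (isOpen_Ioo.mem_nhds hx)).hasDerivAt
  set M := ∫ x in Ioo (-1 : ℝ) 1, exp (2 * g x) with hMdef
  have hcont : ∀ x ∈ Ioo (-1 : ℝ) 1, ContinuousAt (fun x => exp (2 * g x)) x := fun x hx =>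
    (continuousAt_const.mul (hd x hx).continuousAt).rexp
  have hII : IntervalIntegrable (fun x => exp (2 * g x)) volume (-1) 1 := by
    rw [intervalIntegrable_iff_integrableOn_Ioo_of_le (by norm_num)]; exact hexp
  have hMi : ∫ x in (-1 : ℝ)..1, exp (2 * g x) = M := by
    rw [intervalIntegral.integral_of_le (by norm_num), integral_Ioc_eq_integral_Ioo]
  have hM : 0 < M := by
    rw [← hMi]
    exact intervalIntegral.intervalIntegral_pos_of_pos hII (fun x => exp_pos _) (by norm_num)
  let R : ℝ → ℝ := fun y => ∫ x in (-1 : ℝ)..y, exp (2 * g x)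
  have hRc : ContinuousOn R (Icc (-1) 1) := by
    have := intervalIntegral.continuousOn_primitive_interval' hII left_mem_uIcc
    rwa [uIcc_of_le (by norm_num)] at this
  have hR0 : R (-1) = 0 := by simp [R]
  have hR1 : R 1 = M := hMi
  obtain ⟨b, hb, hRb⟩ : ∃ b ∈ Icc (-1 : ℝ) 1, R b = M / 2 := by
    have := intermediate_value_Icc (by norm_num) hRc
    exact this ⟨by rw [hR0]; linarith, by rw [hR1]; linarith⟩
  have hb1 : -1 < b := lt_of_le_of_ne hb.1 (fun h => by
    rw [← h, hR0] at hRb; linarith)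
  have hb2 : b < 1 := lt_of_le_of_ne hb.2 (fun h => by
    rw [h, hR1] at hRb; linarith)
  have hRd : ∀ x ∈ Ioo (-1 : ℝ) 1, HasDerivAt R (exp (2 * g x)) x := by
    intro x hx
    have hco : ContinuousOn (fun x => exp (2 * g x)) (Ioo (-1) 1) :=
      fun y hy => (hcont y hy).continuousWithinAt
    refine intervalIntegral.integral_hasDerivAt_right ?_ ?_ (hcont x hx)
    · refine hII.mono_set ?_
      rw [uIcc_of_le hx.1.le, uIcc_of_le (by norm_num)]
      exact Icc_subset_Icc le_rfl hx.2.le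
    · exact hco.stronglyMeasurableAtFilter isOpen_Ioo x hx
  set N := 2 / M with hN
  have hN0 : 0 < N := by positivity
  let r : ℝ → ℝ := fun y => N * R y - 1
  have hr : ∀ x ∈ Ioo (-1 : ℝ) 1, HasDerivAt r (N * exp (2 * g x)) x := fun x hx =>
    ((hRd x hx).const_mul N).sub_const 1
  have hrc : ContinuousOn r (Icc (-1) 1) := (continuousOn_const.mul hRc).sub continuousOn_const
  have hrb : r b = 0 := by simp only [r, hRb, hN]; field_simp; norm_num
  have hr1 : r 1 = 1 := by simp only [r, hR1, hN]; field_simp; norm_num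
  have hr0 : r (-1) = -1 := by simp only [r, hR0]; norm_num
  obtain ⟨i1, h1⟩ := oa_half b N g (deriv g) r hb1 hb2 hN0 hd hdir hexp hr
    (hrc.mono (Icc_subset_Icc hb1.le le_rfl)) hrb hr1
  have hmem : ∀ x ∈ Ioo (-1 : ℝ) 1, -x ∈ Ioo (-1 : ℝ) 1 := fun x hx =>
    ⟨by linarith [hx.2], by linarith [hx.1]⟩
  have hrefl : ∀ f : ℝ → ℝ, ∀ a c : ℝ, IntegrableOn f (Ioo a c) →
      IntegrableOn (fun x => f (-x)) (Ioo (-c) (-a)) := by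
    intro f a c h
    have := (integrable_indicator_iff measurableSet_Ioo).2 h
    have := this.comp_neg
    rw [← integrable_indicator_iff measurableSet_Ioo]
    refine this.congr (Filter.Eventually.of_forall fun x => ?_)
    simp only [indicator, mem_Ioo]
    have : (a < -x ∧ -x < c) ↔ (-c < x ∧ x < -a) := by
      constructor <;> rintro ⟨h1, h2⟩ <;> constructor <;> linarith
    simp only [this]
  obtain ⟨i2, h2⟩ := oa_half (-b) N (fun x => g (-x)) (fun x => - deriv g (-x))
    (fun x => - r (-x)) (by linarith) (by linarith) hN0
    (fun x hx => by
      refine ((hd (-x) (hmem x hx)).comp x (hasDerivAt_neg x)).congr_deriv ?_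
      ring)
    (by
      have := hrefl _ _ _ hdir
      simpa using this)
    (by
      have := hrefl _ _ _ hexp
      simpa using this)
    (fun x hx => by
      refine (((hr (-x) (hmem x hx)).comp x (hasDerivAt_neg x)).neg).congr_deriv ?_
      ring)
    (by
      refine (hrc.comp (by fun_prop) fun x hx => ?_).neg
      exact ⟨by linarith [hx.2], by linarith [hx.1]⟩)
    (by simpa using hrb) (by simp [hr0])
  have i2' : IntegrableOn g (Ioo (-1) b) := by
    have := hrefl _ _ _ i2
    simpa using this
  set k := (log (1 + b) - log (1 - b)) / 2 with hk
  let φ : ℝ → ℝ := fun x => 1 / 2 * ((1 - x ^ 2) * (deriv g x) ^ 2) + 2 * g x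
        + log N * (N * exp (2 * g x)) + 2 * k * (N * exp (2 * g x) * x)
  have h2' : -2 * (log (1 + b) - log (1 - b)) + 2 * b * g b + 2 * b ≤ ∫ x in (-1)..b, φ x := by
    have e := intervalIntegral.integral_comp_neg (a := -b) (b := 1) φ
    rw [neg_neg] at e
    rw [← e]
    have e2 : (log (1 + -b) - log (1 - -b)) / 2 = - k := by
      rw [hk, sub_neg_eq_add, ← sub_eq_add_neg]; ring
    rw [e2] at h2
    simp only [neg_neg, sub_neg_eq_add, ← sub_eq_add_neg] at h2
    refine le_trans (by linarith) (h2.trans (le_of_eq ?_))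
    congr 1
    funext x
    simp only [φ]
    ring
  have hgI : IntervalIntegrable g volume (-1) 1 := by
    refine IntervalIntegrable.trans (b := b) ?_ ?_
    · rwa [intervalIntegrable_iff_integrableOn_Ioo_of_le hb1.le]
    · rwa [intervalIntegrable_iff_integrableOn_Ioo_of_le hb2.le]
  have hgi : IntegrableOn g (Ioo (-1) 1) := by
    rwa [intervalIntegrable_iff_integrableOn_Ioo_of_le (by norm_num)] at hgI
  have hex : IntegrableOn (fun x => exp (2 * g x) * x) (Ioo (-1) 1) := by
    refine hexp.mul_bdd (c := 1) (by fun_prop) ?_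
    filter_upwards [ae_restrict_mem measurableSet_Ioo] with x hx
    rw [norm_eq_abs, abs_le]
    constructor <;> linarith [hx.1, hx.2]
  have hφe : φ = fun x => 1 / 2 * ((1 - x ^ 2) * (deriv g x) ^ 2) + 2 * g x
        + log N * N * exp (2 * g x) + 2 * k * N * (exp (2 * g x) * x) := by
    funext x; simp only [φ]; ring
  have j1 : Integrable (fun x => 1 / 2 * ((1 - x ^ 2) * (deriv g x) ^ 2))
    (volume.restrict (Ioo (-1) 1)) := hdir.const_mul (1 / 2)
  have j2 := hgi.const_mul 2
  have j3 := hexp.const_mul (log N * N)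
  have j4 := hex.const_mul (2 * k * N)
  have j12 : Integrable (fun x => 1 / 2 * ((1 - x ^ 2) * (deriv g x) ^ 2) + 2 * g x)
    (volume.restrict (Ioo (-1) 1)) := j1.add j2
  have j123 : Integrable (fun x => 1 / 2 * ((1 - x ^ 2) * (deriv g x) ^ 2) + 2 * g x
    + log N * N * exp (2 * g x)) (volume.restrict (Ioo (-1) 1)) := j12.add j3
  have hφi : IntegrableOn φ (Ioo (-1) 1) := by
    rw [hφe]; exact ((j1.add j2).add j3).add j4
  have hφI : IntervalIntegrable φ volume (-1) 1 := by
    rw [intervalIntegrable_iff_integrableOn_Ioo_of_le (by norm_num)]; exact hφi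
  have hsum : ∫ x in (-1 : ℝ)..1, φ x = (∫ x in (-1 : ℝ)..b, φ x) + ∫ x in b..1, φ x := by
    symm
    apply intervalIntegral.integral_add_adjacent_intervals
    · refine hφI.mono_set ?_
      rw [uIcc_of_le hb1.le, uIcc_of_le (by norm_num)]
      exact Icc_subset_Icc le_rfl hb2.le
    · refine hφI.mono_set ?_
      rw [uIcc_of_le hb2.le, uIcc_of_le (by norm_num)]
      exact Icc_subset_Icc hb1.le le_rfl
  have htot : ∫ x in (-1 : ℝ)..1, φ x
      = 1 / 2 * (∫ x in Ioo (-1 : ℝ) 1, (1 - x ^ 2) * (deriv g x) ^ 2)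
        + 2 * (∫ x in Ioo (-1 : ℝ) 1, g x) + log N * N * M := by
    rw [intervalIntegral.integral_of_le (by norm_num), integral_Ioc_eq_integral_Ioo, hφe,
      integral_add j123 j4, integral_add j12 j3, integral_add j1 j2,
      integral_const_mul, integral_const_mul, integral_const_mul, integral_const_mul,
      hconstraint, mul_zero, add_zero]
  have hNM : log N * N * M = 2 * log N := by
    rw [hN]; field_simp
  have hlog : log (1 / 2 * M) = - log N := by
    rw [← log_inv, hN]; congr 1; field_simp
  rw [hNM] at htot
  rw [hlog]
  have h1' : 2 * (log (1 + b) - log (1 - b)) - 2 * b * g b - 2 * b ≤ ∫ x in b..1, φ x := h1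
  linarith
end

section
/- (Nodal domain count) Let K : ℝ² → ℝ be a smooth (C^∞) function and let φ : ℝ² → ℝ be a C² function, not identically zero, satisfying Δφ(y) + K(y) φ(y) = 0 on ℝ², φ(0) = 0, and ∇φ(0) = 0. Then the open set ℝ² \ {y : φ(y) = 0} has at least 3 connected components. -/
open MeasureTheory Real

/-- The Euclidean Laplacian on `ℝ²`: the sum of the two pure second partial
derivatives in the standard coordinate directions. -/
noncomputable def planeLaplacian (v : EuclideanSpace ℝ (Fin 2) → ℝ)
    (y : EuclideanSpace ℝ (Fin 2)) : ℝ :=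
  ∑ i : Fin 2,
    fderiv ℝ (fun z => fderiv ℝ v z (EuclideanSpace.single i 1)) y
      (EuclideanSpace.single i 1)

namespace Nodal

lemma exists_lift (H : ℝ × ℝ → ℂ) (hc : Continuous H) (hn : ∀ x, H x ≠ 0) :
    ∃ L : ℝ × ℝ → ℂ, Continuous L ∧ ∀ x, Complex.exp (L x) = H x := by
  obtain ⟨F, ⟨_, hF⟩, _⟩ := Complex.isCoveringMapOn_exp.existsUnique_continuousMap_lifts
    (⟨H, hc⟩ : C(ℝ × ℝ, ℂ)) (a₀ := (0, 0)) (e₀ := Complex.log (H (0, 0)))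
    (by simpa using Complex.exp_log (hn _)) (by intro a; simpa using hn a)
  exact ⟨F, F.continuous, fun x => congrFun hF x⟩

lemma lift_unique (f g : ℝ → ℂ) (hf : Continuous f) (hg : Continuous g) (c : ℂ) (hc : c ≠ 0)
    (h : ∀ t, Complex.exp (f t) = c * Complex.exp (g t)) : f 1 - f 0 = g 1 - g 0 := by
  set d : ℝ → ℂ := fun t => f t - (g t + (f 0 - g 0)) with hd
  have key : f = fun t => g t + (f 0 - g 0) := by
    have hc' : Complex.exp (f 0 - g 0) = c := by
      rw [Complex.exp_sub, h 0]; field_simp [Complex.exp_ne_zero]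
    refine Complex.isCoveringMap_exp.eq_of_comp_eq hf (by fun_prop) ?_ 0 (by simp)
    funext t
    simp only [Function.comp, Subtype.mk.injEq]
    rw [h t, Complex.exp_add, hc']; ring
  have := congrFun key 1
  rw [this]; ring

lemma square (H : ℝ × ℝ → ℂ) (hc : Continuous H) (hn : ∀ x, H x ≠ 0)
    (b t l r : ℝ → ℂ) (hb : Continuous b) (ht : Continuous t) (hl : Continuous l)
    (hr : Continuous r) (cb ct cl cr : ℂ)
    (cb0 : cb ≠ 0) (ct0 : ct ≠ 0) (cl0 : cl ≠ 0) (cr0 : cr ≠ 0)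
    (eb : ∀ s, Complex.exp (b s) = cb * H (s, 0)) (et : ∀ s, Complex.exp (t s) = ct * H (s, 1))
    (el : ∀ s, Complex.exp (l s) = cl * H (0, s)) (er : ∀ s, Complex.exp (r s) = cr * H (1, s)) :
    (b 1 - b 0) + (r 1 - r 0) = (t 1 - t 0) + (l 1 - l 0) := by
  obtain ⟨L, hL, hLe⟩ := exists_lift H hc hn
  have h1 := lift_unique b (fun s => L (s, 0)) hb (by fun_prop) cb cb0 (by simpa [hLe] using eb)
  have h2 := lift_unique t (fun s => L (s, 1)) ht (by fun_prop) ct ct0 (by simpa [hLe] using et)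
  have h3 := lift_unique l (fun s => L (0, s)) hl (by fun_prop) cl cl0 (by simpa [hLe] using el)
  have h4 := lift_unique r (fun s => L (1, s)) hr (by fun_prop) cr cr0 (by simpa [hLe] using er)
  rw [h1, h2, h3, h4]; ring

/-- clamp to the unit interval -/
noncomputable def clp (r : ℝ) : ℝ := max 0 (min 1 r)

lemma clp_cont : Continuous clp := by unfold clp; fun_prop
lemma clp_mem (r : ℝ) : 0 ≤ clp r ∧ clp r ≤ 1 := by unfold clp; simp
lemma clp_zero : clp 0 = 0 := by simp [clp]
lemma clp_one : clp 1 = 1 := by simp [clp]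

lemma slit_comb (w : ℂ) (hw : -w ∈ Complex.slitPlane) (a b : ℝ) (ha : 0 ≤ a) (hb : 0 ≤ b)
    (hab : 0 < a + b) : (a : ℂ) - b * w ∈ Complex.slitPlane := by
  rw [Complex.mem_slitPlane_iff] at *
  simp at *
  by_cases hb0 : b = 0
  · left; subst hb0; simp; linarith
  · have hb1 : 0 < b := lt_of_le_of_ne hb (Ne.symm hb0)
    rcases hw with h | h
    · left; nlinarith
    · right; exact ⟨hb0, h⟩

lemma sideA (A : ℝ → ℂ) (hA : Continuous A) (n : ℂ)
    (h : ∀ s r : ℝ, 0 ≤ r → r ≤ 1 → A s ≠ r * n)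
    (h0 : -(n / A 0) ∈ Complex.slitPlane) (h1 : -(n / A 1) ∈ Complex.slitPlane)
    (lam ell : ℝ → ℂ) (hlam : Continuous lam) (hell : Continuous ell)
    (elam : ∀ s, Complex.exp (lam s) = A s) (eell : ∀ s, Complex.exp (ell s) = A s - n) :
    (lam 1 - lam 0) + Complex.log (1 - n / A 1) = (ell 1 - ell 0) + Complex.log (1 - n / A 0) := by
  have hA0 : ∀ s, A s ≠ 0 := fun s => by simpa using h s 0 le_rfl zero_le_one
  have hcl : Continuous (fun r : ℝ => ((clp r : ℝ) : ℂ)) :=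
    Complex.continuous_ofReal.comp clp_cont
  have slit : ∀ w : ℂ, -w ∈ Complex.slitPlane → ∀ r, 1 - (clp r : ℂ) * w ∈ Complex.slitPlane := by
    intro w hw r
    simpa using slit_comb w hw 1 (clp r) zero_le_one (clp_mem r).1 (by linarith [(clp_mem r).1])
  have := square (fun x => A x.1 - clp x.2 * n)
    (by have := hcl.comp (continuous_snd (X := ℝ) (Y := ℝ)); simp only [Function.comp_def] at this; fun_prop)
    (fun x => sub_ne_zero.2 (h _ _ (clp_mem _).1 (clp_mem _).2)) lam ell
    (fun r => Complex.log (1 - clp r * (n / A 0))) (fun r => Complex.log (1 - clp r * (n / A 1)))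
    hlam hell
    (Continuous.clog (by fun_prop) (slit _ h0)) (Continuous.clog (by fun_prop) (slit _ h1))
    1 1 (A 0)⁻¹ (A 1)⁻¹ one_ne_zero one_ne_zero (inv_ne_zero (hA0 _)) (inv_ne_zero (hA0 _))
    (by simp [clp_zero, elam]) (by simp [clp_one, eell])
    (fun r => by
      rw [Complex.exp_log (Complex.slitPlane_ne_zero (slit _ h0 r))]; field_simp [hA0 0])
    (fun r => by
      rw [Complex.exp_log (Complex.slitPlane_ne_zero (slit _ h1 r))]; field_simp [hA0 1])
  simpa [clp_zero, clp_one] using this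

lemma sideB (B : ℝ → ℂ) (hB : Continuous B) (p : ℂ) (hp : p ≠ 0)
    (h : ∀ s r : ℝ, 0 ≤ r → r ≤ 1 → B s ≠ r * p)
    (h0 : -(B 0 / p) ∈ Complex.slitPlane) (h1 : -(B 1 / p) ∈ Complex.slitPlane)
    (lam ell : ℝ → ℂ) (hlam : Continuous lam) (hell : Continuous ell)
    (elam : ∀ s, Complex.exp (lam s) = -B s) (eell : ∀ s, Complex.exp (ell s) = p - B s) :
    (lam 1 - lam 0) + (Complex.log (1 - B 1 / p) - Complex.log (-(B 1 / p)))
     = (ell 1 - ell 0) + (Complex.log (1 - B 0 / p) - Complex.log (-(B 0 / p))) := by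
  have hcl : Continuous (fun r : ℝ => ((clp r : ℝ) : ℂ)) :=
    Complex.continuous_ofReal.comp clp_cont
  have slit : ∀ w : ℂ, -w ∈ Complex.slitPlane → ∀ r, (clp r : ℂ) - w ∈ Complex.slitPlane := by
    intro w hw r
    simpa using slit_comb w hw (clp r) 1 (clp_mem r).1 zero_le_one (by linarith [(clp_mem r).1])
  have := square (fun x => clp x.2 * p - B x.1)
    (by have := hcl.comp (continuous_snd (X := ℝ) (Y := ℝ)); simp only [Function.comp_def] at this; fun_prop)
    (fun x => sub_ne_zero.2 (h _ _ (clp_mem _).1 (clp_mem _).2).symm) lam ell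
    (fun r => Complex.log (clp r - (B 0 / p))) (fun r => Complex.log (clp r - (B 1 / p)))
    hlam hell
    (Continuous.clog (by fun_prop) (slit _ h0)) (Continuous.clog (by fun_prop) (slit _ h1))
    1 1 p⁻¹ p⁻¹ one_ne_zero one_ne_zero (inv_ne_zero hp) (inv_ne_zero hp)
    (by simp [clp_zero, elam]) (by simp [clp_one, eell])
    (fun r => by
      rw [Complex.exp_log (Complex.slitPlane_ne_zero (slit _ h0 r))]; field_simp)
    (fun r => by
      rw [Complex.exp_log (Complex.slitPlane_ne_zero (slit _ h1 r))]; field_simp)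
  simpa [clp_zero, clp_one] using this

lemma crossing (A B : ℝ → ℂ) (hA : Continuous A) (hB : Continuous B)
    (hAB : ∀ s t, A s ≠ B t)
    (hA0 : ∀ s r : ℝ, 0 ≤ r → r ≤ 1 → A s ≠ r * B 0)
    (hA1 : ∀ s r : ℝ, 0 ≤ r → r ≤ 1 → A s ≠ r * B 1)
    (hB0 : ∀ s r : ℝ, 0 ≤ r → r ≤ 1 → B s ≠ r * A 0)
    (hB1 : ∀ s r : ℝ, 0 ≤ r → r ≤ 1 → B s ≠ r * A 1)
    (s00 : -(B 0 / A 0) ∈ Complex.slitPlane) (s10 : -(B 1 / A 0) ∈ Complex.slitPlane)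
    (s01 : -(B 0 / A 1) ∈ Complex.slitPlane) (s11 : -(B 1 / A 1) ∈ Complex.slitPlane) :
    Complex.log (-(B 0 / A 1)) - Complex.log (-(B 0 / A 0)) - Complex.log (-(B 1 / A 1))
      + Complex.log (-(B 1 / A 0)) = 0 := by
  have path_lift : ∀ f : ℝ → ℂ, Continuous f → (∀ s, f s ≠ 0) →
      ∃ l : ℝ → ℂ, Continuous l ∧ ∀ s, Complex.exp (l s) = f s := by
    intro f hf h0
    obtain ⟨L, hL, e⟩ := exists_lift (fun x => f x.1) (by fun_prop) (fun x => h0 _)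
    exact ⟨fun s => L (s, 0), by fun_prop, fun s => e _⟩
  have nA : ∀ s, A s ≠ 0 := fun s => by simpa using hA0 s 0 le_rfl zero_le_one
  have nB : ∀ s, B s ≠ 0 := fun s => by simpa using hB0 s 0 le_rfl zero_le_one
  obtain ⟨lA, cA, eA⟩ := path_lift A hA nA
  obtain ⟨lB, cB, eB⟩ := path_lift (fun s => -B s) (by fun_prop) (fun s => neg_ne_zero.2 (nB s))
  obtain ⟨b, cb, eb⟩ := path_lift (fun s => A s - B 0) (by fun_prop) (fun s => sub_ne_zero.2 (hAB _ _))
  obtain ⟨t, ct, et⟩ := path_lift (fun s => A s - B 1) (by fun_prop) (fun s => sub_ne_zero.2 (hAB _ _))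
  obtain ⟨l, cl, el⟩ := path_lift (fun s => A 0 - B s) (by fun_prop) (fun s => sub_ne_zero.2 (hAB _ _))
  obtain ⟨r, cr, er⟩ := path_lift (fun s => A 1 - B s) (by fun_prop) (fun s => sub_ne_zero.2 (hAB _ _))
  have h := square (fun x => A x.1 - B x.2) (by fun_prop) (fun x => sub_ne_zero.2 (hAB _ _))
    b t l r cb ct cl cr 1 1 1 1 one_ne_zero one_ne_zero one_ne_zero one_ne_zero
    (by simpa using eb) (by simpa using et) (by simpa using el) (by simpa using er)
  have h1 := sideA A hA (B 0) hA0 s00 s01 lA b cA cb eA eb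
  have h2 := sideA A hA (B 1) hA1 s10 s11 lA t cA ct eA et
  have h3 := sideB B hB (A 0) (nA 0) hB0 s00 s10 lB l cB cl eB el
  have h4 := sideB B hB (A 1) (nA 1) hB1 s01 s11 lB r cB cr eB er
  linear_combination h + h1 - h2 - h3 + h4


abbrev E2 := EuclideanSpace ℝ (Fin 2)

/-- polar point -/
noncomputable def pol (ρ θ : ℝ) : E2 := !₂[ρ * Real.cos θ, ρ * Real.sin θ]

noncomputable def toC (y : E2) : ℂ := ⟨y 0, y 1⟩

lemma toC_cont : Continuous toC := by
  have : toC = fun y : E2 => (y 0 : ℂ) + (y 1 : ℂ) * Complex.I := by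
    funext y; apply Complex.ext <;> simp [toC]
  rw [this]; fun_prop

lemma toC_inj {x y : E2} (h : toC x = toC y) : x = y := by
  have h0 := congrArg Complex.re h
  have h1 := congrArg Complex.im h
  simp only [toC] at h0 h1
  ext i; fin_cases i <;> simpa

lemma toC_pol (ρ θ : ℝ) : toC (pol ρ θ) = ρ * Complex.exp (θ * Complex.I) := by
  apply Complex.ext <;> simp [toC, pol, Complex.exp_ofReal_mul_I_re, Complex.exp_ofReal_mul_I_im]

lemma comp_pos (f : E2 → ℝ) (hf : Continuous f) (x : E2) (hx : 0 < f x) :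
    ∀ z ∈ connectedComponentIn {y | f y ≠ 0} x, 0 < f z := by
  intro z hz
  by_contra hneg
  have hxS : x ∈ {y | f y ≠ 0} := hx.ne'
  have hpre := isPreconnected_connectedComponentIn (x := x) (F := {y | f y ≠ 0})
  have := hpre.intermediate_value hz (mem_connectedComponentIn hxS) hf.continuousOn
  obtain ⟨w, hw, hw0⟩ := this ⟨not_lt.1 hneg, hx.le⟩
  exact (connectedComponentIn_subset _ _ hw) hw0

lemma exists_curve (f : E2 → ℝ) (hf : Continuous f) (x y : E2) (hx : 0 < f x) (hy : f y ≠ 0)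
    (h : connectedComponentIn {y | f y ≠ 0} x = connectedComponentIn {y | f y ≠ 0} y) :
    ∃ A : ℝ → E2, Continuous A ∧ A 0 = x ∧ A 1 = y ∧ ∀ s, 0 < f (A s) := by
  have ho : IsOpen {y | f y ≠ 0} := isOpen_ne_fun hf continuous_const
  have hxS : x ∈ {y | f y ≠ 0} := hx.ne'
  have hc : IsConnected (connectedComponentIn {y | f y ≠ 0} x) :=
    isConnected_connectedComponentIn_iff.2 hxS
  have hp := (IsOpen.isConnected_iff_isPathConnected (ho.connectedComponentIn)).1 hc
  have hyx : y ∈ connectedComponentIn {y | f y ≠ 0} x := by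
    rw [h]; exact mem_connectedComponentIn hy
  obtain ⟨γ, hγ⟩ := hp.joinedIn x (mem_connectedComponentIn hxS) y hyx
  refine ⟨γ.extend, γ.continuous_extend, by simp, by simp, fun s => ?_⟩
  apply comp_pos f hf x hx
  exact hγ (Set.projIcc 0 1 zero_le_one s)

lemma comp_ne (f : E2 → ℝ) (hf : Continuous f) (x y : E2) (hx : 0 < f x) (hy : f y < 0) :
    connectedComponentIn {y | f y ≠ 0} x ≠ connectedComponentIn {y | f y ≠ 0} y := by
  intro h
  have hyx : y ∈ connectedComponentIn {y | f y ≠ 0} x := by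
    rw [h]; exact mem_connectedComponentIn hy.ne
  linarith [comp_pos f hf x hx y hyx]

lemma ratio_exp (ε a b : ℝ) (hε : 0 < ε) :
    -(toC (pol ε b) / toC (pol ε a)) = Complex.exp (((b - a - π : ℝ) : ℂ) * Complex.I) := by
  have : (ε : ℂ) ≠ 0 := by exact_mod_cast hε.ne'
  rw [toC_pol, toC_pol, mul_div_mul_left _ _ this, ← Complex.exp_sub]
  have : (((b - a - π : ℝ) : ℂ) * Complex.I) = (b * Complex.I - a * Complex.I) - π * Complex.I := by
    push_cast; ring
  rw [this, Complex.exp_sub _ (π * Complex.I), Complex.exp_pi_mul_I]; ring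

lemma ratio_exp' (ε a b : ℝ) (hε : 0 < ε) :
    -(toC (pol ε b) / toC (pol ε a)) = Complex.exp (((b - a + π : ℝ) : ℂ) * Complex.I) := by
  rw [ratio_exp ε a b hε]
  have : (((b - a + π : ℝ) : ℂ) * Complex.I) = (((b - a - π : ℝ) : ℂ) * Complex.I) + 2 * π * Complex.I := by
    push_cast; ring
  rw [this, Complex.exp_add, Complex.exp_two_pi_mul_I, mul_one]

lemma exp_slit (x : ℝ) (h1 : -π < x) (h2 : x < π) :
    Complex.exp ((x : ℂ) * Complex.I) ∈ Complex.slitPlane := by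
  rw [Complex.mem_slitPlane_iff_arg]
  refine ⟨?_, Complex.exp_ne_zero _⟩
  rw [Complex.arg_exp_mul_I, (toIocMod_eq_self _).2 ⟨h1, by linarith⟩]
  exact h2.ne

lemma exp_log' (x : ℝ) (h1 : -π < x) (h2 : x < π) :
    Complex.log (Complex.exp ((x : ℂ) * Complex.I)) = x * Complex.I :=
  Complex.log_exp (by simpa using h1) (by simpa using h2.le)

lemma toC_pol_smul (r ε a : ℝ) : (r : ℂ) * toC (pol ε a) = toC (pol (r * ε) a) := by
  rw [toC_pol, toC_pol]; push_cast; ring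

theorem three_of_rays (f : E2 → ℝ) (hf : Continuous f) (hf0 : f 0 = 0) (m : ℕ) (hm : 2 ≤ m)
    (ε θ : ℝ) (hε : 0 < ε)
    (h1 : ∀ ρ, 0 < ρ → ρ ≤ ε → 0 < f (pol ρ θ))
    (h2 : ∀ ρ, 0 < ρ → ρ ≤ ε → f (pol ρ (θ + π / m)) < 0)
    (h3 : ∀ ρ, 0 < ρ → ρ ≤ ε → 0 < f (pol ρ (θ + 2 * (π / m))))
    (h4 : ∀ ρ, 0 < ρ → ρ ≤ ε → f (pol ρ (θ + 3 * (π / m))) < 0) :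
    ∃ y₁ y₂ y₃ : E2,
      f y₁ ≠ 0 ∧ f y₂ ≠ 0 ∧ f y₃ ≠ 0 ∧
      connectedComponentIn {y | f y ≠ 0} y₁ ≠ connectedComponentIn {y | f y ≠ 0} y₂ ∧
      connectedComponentIn {y | f y ≠ 0} y₁ ≠ connectedComponentIn {y | f y ≠ 0} y₃ ∧
      connectedComponentIn {y | f y ≠ 0} y₂ ≠ connectedComponentIn {y | f y ≠ 0} y₃ := by
  have q1 := h1 ε hε le_rfl
  have q2 := h2 ε hε le_rfl
  have q3 := h3 ε hε le_rfl
  have q4 := h4 ε hε le_rfl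
  by_cases c13 : connectedComponentIn {y | f y ≠ 0} (pol ε θ)
      = connectedComponentIn {y | f y ≠ 0} (pol ε (θ + 2 * (π / m)))
  swap
  · exact ⟨_, _, _, q1.ne', q3.ne', q2.ne, c13, comp_ne f hf _ _ q1 q2, comp_ne f hf _ _ q3 q2⟩
  by_cases c24 : connectedComponentIn {y | f y ≠ 0} (pol ε (θ + π / m))
      = connectedComponentIn {y | f y ≠ 0} (pol ε (θ + 3 * (π / m)))
  swap
  · exact ⟨_, _, _, q1.ne', q2.ne, q4.ne, comp_ne f hf _ _ q1 q2, comp_ne f hf _ _ q1 q4, c24⟩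
  exfalso
  obtain ⟨A, cA, A0, A1, pA⟩ := exists_curve f hf _ _ q1 q3.ne' c13
  obtain ⟨B, cB, B0, B1, pB⟩ := exists_curve (fun y => - f y) (by fun_prop) _ _
    (by simpa using q2) (by simpa using q4.ne) (by simpa using c24)
  have pol0 : ∀ a, pol 0 a = 0 := by
    intro a; ext i; fin_cases i <;> simp [pol]
  have m2 : (2 : ℝ) ≤ m := by exact_mod_cast hm
  have pm : 0 < π / m := by positivity
  have pm2 : π / m ≤ π / 2 := by gcongr
  have hpi := Real.pi_pos
  have neg_le : ∀ (a : ℝ), (∀ ρ, 0 < ρ → ρ ≤ ε → f (pol ρ a) < 0) → ∀ r : ℝ, 0 ≤ r → r ≤ 1 →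
      f (pol (r * ε) a) ≤ 0 := by
    intro a h r hr0 hr1
    rcases hr0.eq_or_lt with rfl | hr
    · simp [pol0, hf0]
    · exact (h _ (by positivity) (by nlinarith)).le
  have pos_ge : ∀ (a : ℝ), (∀ ρ, 0 < ρ → ρ ≤ ε → 0 < f (pol ρ a)) → ∀ r : ℝ, 0 ≤ r → r ≤ 1 →
      0 ≤ f (pol (r * ε) a) := by
    intro a h r hr0 hr1
    rcases hr0.eq_or_lt with rfl | hr
    · simp [pol0, hf0]
    · exact (h _ (by positivity) (by nlinarith)).le
  have avoidA : ∀ (a : ℝ), (∀ ρ, 0 < ρ → ρ ≤ ε → f (pol ρ a) < 0) → ∀ s r : ℝ, 0 ≤ r → r ≤ 1 →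
      toC (A s) ≠ r * toC (pol ε a) := by
    intro a h s r hr0 hr1 he
    rw [toC_pol_smul] at he
    have := toC_inj he
    have h' := pA s
    rw [this] at h'
    linarith [neg_le a h r hr0 hr1]
  have avoidB : ∀ (a : ℝ), (∀ ρ, 0 < ρ → ρ ≤ ε → 0 < f (pol ρ a)) → ∀ s r : ℝ, 0 ≤ r → r ≤ 1 →
      toC (B s) ≠ r * toC (pol ε a) := by
    intro a h s r hr0 hr1 he
    rw [toC_pol_smul] at he
    have := toC_inj he
    have h' := pB s
    rw [this] at h'
    linarith [pos_ge a h r hr0 hr1]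
  have key := crossing (fun s => toC (A s)) (fun s => toC (B s)) (toC_cont.comp cA)
    (toC_cont.comp cB)
    (fun s t he => by
      have h' := pB t
      rw [← toC_inj he] at h'
      linarith [pA s])
    (by simp only [B0]; exact avoidA _ h2) (by simp only [B1]; exact avoidA _ h4)
    (by simp only [A0]; exact avoidB _ h1) (by simp only [A1]; exact avoidB _ h3)
    (by simp only [A0, B0]; rw [ratio_exp _ _ _ hε]; apply exp_slit <;> linarith)
    (by simp only [A0, B1]; rw [ratio_exp _ _ _ hε]; apply exp_slit <;> linarith)
    (by simp only [A1, B0]; rw [ratio_exp' _ _ _ hε]; apply exp_slit <;> linarith)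
    (by simp only [A1, B1]; rw [ratio_exp _ _ _ hε]; apply exp_slit <;> linarith)
  simp only [A0, A1, B0, B1] at key
  rw [ratio_exp' ε (θ + 2 * (π / m)) (θ + π / m) hε, ratio_exp ε θ (θ + π / m) hε,
    ratio_exp ε (θ + 2 * (π / m)) (θ + 3 * (π / m)) hε, ratio_exp ε θ (θ + 3 * (π / m)) hε,
    exp_log' _ (by linarith) (by linarith), exp_log' _ (by linarith) (by linarith),
    exp_log' _ (by linarith) (by linarith), exp_log' _ (by linarith) (by linarith)] at key
  have := congrArg Complex.im key
  simp only [← sub_mul, ← add_mul, ← Complex.ofReal_sub, ← Complex.ofReal_add] at this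
  simp at this
  linarith

lemma exp_lin_deriv (c t : ℝ) : HasDerivAt (fun s : ℝ => Real.exp (c * s)) (c * Real.exp (c * t)) t := by
  have := ((hasDerivAt_id t).const_mul c).exp
  simpa [mul_comm] using this

lemma exp_lin_tendsto (c : ℝ) (hc : 0 < c) :
    Filter.Tendsto (fun s : ℝ => Real.exp (c * s)) Filter.atBot (nhds 0) :=
  Real.tendsto_exp_atBot.comp (Filter.Tendsto.const_mul_atBot hc Filter.tendsto_id)

lemma max_principle (w w1 w2 : ℝ → ℝ) (T : ℝ) (hw : ∀ t, HasDerivAt w (w1 t) t)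
    (hw1 : ∀ t, HasDerivAt w1 (w2 t) t) (hT : w T ≤ 0)
    (hpos : ∀ t ≤ T, 0 < w t → 0 < w2 t)
    (b : ℝ → ℝ) (hb : Filter.Tendsto b Filter.atBot (nhds 0)) (hwb : ∀ t ≤ T, w t ≤ b t) :
    ∀ t ≤ T, w t ≤ 0 := by
  intro t0 ht0
  by_contra hcon
  push Not at hcon
  have hlt : t0 < T := lt_of_le_of_ne ht0 (by rintro rfl; linarith)
  obtain ⟨t1, ht1⟩ := ((hb.eventually (gt_mem_nhds hcon)).and
    (Filter.eventually_lt_atBot t0)).exists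
  have hcw : Continuous w := continuous_iff_continuousAt.2 fun t => (hw t).continuousAt
  have h1 : w t1 < w t0 := lt_of_le_of_lt (hwb t1 (by linarith)) ht1.1
  obtain ⟨x, hx, hmax⟩ := isCompact_Icc.exists_isMaxOn (s := Set.Icc t1 T)
    ⟨t0, ht1.2.le, ht0⟩ hcw.continuousOn
  have hx0 : w t0 ≤ w x := hmax ⟨ht1.2.le, ht0⟩
  have hx1 : t1 < x := lt_of_le_of_ne hx.1 (by rintro rfl; linarith)
  have hx2 : x < T := lt_of_le_of_ne hx.2 (by rintro rfl; linarith)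
  have hloc : IsLocalMax w x := hmax.isLocalMax (Icc_mem_nhds hx1 hx2)
  have hd : deriv w = w1 := funext fun t => (hw t).deriv
  have hdd : deriv w1 = w2 := funext fun t => (hw1 t).deriv
  have hz : w1 x = 0 := hloc.hasDerivAt_eq_zero (hw x)
  have h2pos : 0 < w2 x := hpos x hx.2 (by linarith)
  have hmin : IsLocalMin w x := isLocalMin_of_deriv_deriv_pos (by rw [hd, hdd]; exact h2pos)
    (by rw [hd]; exact hz) hcw.continuousAt
  have hconst : w =ᶠ[nhds x] fun _ => w x := by
    filter_upwards [hloc, hmin] with y h1 h2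
    exact le_antisymm h1 h2
  have hw1e : w1 =ᶠ[nhds x] fun _ => 0 := by
    have := hconst.deriv
    rw [hd] at this
    simpa using this
  have : w2 x = 0 := by
    have := hw1e.deriv_eq
    rw [hdd] at this
    simpa using this
  linarith

lemma ode_high (a a1 g : ℝ → ℂ) (k μ ν G M T : ℝ) (hμ : 0 < μ) (hk : μ < k) (hν : 0 < ν)
    (ha : ∀ t, HasDerivAt a (a1 t) t) (ha1 : ∀ t, HasDerivAt a1 ((k ^ 2 : ℝ) * a t + g t) t)
    (hg : ∀ t ≤ T, ‖g t‖ ≤ G * Real.exp (μ * t)) (hG : 0 ≤ G)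
    (hM : ∀ t ≤ T, ‖a t‖ ≤ M * Real.exp (ν * t)) :
    ∀ t ≤ T, ‖a t‖ ≤ (‖a T‖ * Real.exp (-(μ * T)) + G / (k ^ 2 - μ ^ 2)) * Real.exp (μ * t) := by
  intro t0 ht0
  set B := ‖a T‖ * Real.exp (-(μ * T)) + G / (k ^ 2 - μ ^ 2) with hB
  have hkm : 0 < k ^ 2 - μ ^ 2 := by nlinarith
  have hB0 : 0 ≤ B := by positivity
  have hBG : G ≤ B * (k ^ 2 - μ ^ 2) := by
    have : G = G / (k ^ 2 - μ ^ 2) * (k ^ 2 - μ ^ 2) := by field_simp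
    rw [this]
    apply mul_le_mul_of_nonneg_right _ hkm.le
    rw [hB]
    have : 0 ≤ ‖a T‖ * Real.exp (-(μ * T)) := by positivity
    linarith
  by_cases hz : a t0 = 0
  · rw [hz]; simp; positivity
  set l : ℂ := (starRingEnd ℂ) (a t0) / ‖a t0‖ with hl
  have hn0 : ‖a t0‖ ≠ 0 := norm_ne_zero_iff.2 hz
  have hl1 : ‖l‖ = 1 := by rw [hl, norm_div]; simp [hn0]
  have hla : (l * a t0).re = ‖a t0‖ := by
    have hsq : (starRingEnd ℂ) (a t0) * a t0 = ((‖a t0‖ ^ 2 : ℝ) : ℂ) := by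
      rw [mul_comm, Complex.mul_conj, Complex.normSq_eq_norm_sq]
    have : l * a t0 = ((‖a t0‖ : ℝ) : ℂ) := by
      have hn0' : ((‖a t0‖ : ℝ) : ℂ) ≠ 0 := by exact_mod_cast hn0
      rw [hl, div_mul_eq_mul_div, hsq]
      push_cast
      field_simp
    rw [this, Complex.ofReal_re]
  have hre : ∀ z : ℂ, |(l * z).re| ≤ ‖z‖ := fun z => by
    have := Complex.abs_re_le_norm (l * z)
    rwa [norm_mul, hl1, one_mul] at this
  have dre : ∀ (f : ℝ → ℂ) (f' : ℂ) (t : ℝ), HasDerivAt f f' t →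
      HasDerivAt (fun s => (l * f s).re) ((l * f').re) t := by
    intro f f' t h
    exact Complex.reCLM.hasFDerivAt.comp_hasDerivAt t (h.const_mul l)
  have key := max_principle (fun t => (l * a t).re - B * Real.exp (μ * t))
    (fun t => (l * a1 t).re - B * (μ * Real.exp (μ * t)))
    (fun t => (l * ((k ^ 2 : ℝ) * a t + g t)).re - B * (μ * (μ * Real.exp (μ * t)))) T
    (fun t => (dre _ _ _ (ha t)).sub ((exp_lin_deriv μ t).const_mul B))
    (fun t => (dre _ _ _ (ha1 t)).sub (((exp_lin_deriv μ t).const_mul μ).const_mul B))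
    (by
      have h1 := (abs_le.1 (hre (a T))).2
      have h2 : ‖a T‖ ≤ B * Real.exp (μ * T) := by
        have : ‖a T‖ = ‖a T‖ * Real.exp (-(μ * T)) * Real.exp (μ * T) := by
          rw [mul_assoc, ← Real.exp_add]; simp
        rw [this]
        apply mul_le_mul_of_nonneg_right _ (Real.exp_pos _).le
        rw [hB]
        have : 0 ≤ G / (k ^ 2 - μ ^ 2) := by positivity
        linarith
      linarith)
    (by
      intro t ht hp
      have e : (l * (((k ^ 2 : ℝ) : ℂ) * a t + g t)).re = k ^ 2 * (l * a t).re + (l * g t).re := by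
        rw [mul_add, Complex.add_re, mul_left_comm, Complex.re_ofReal_mul]
      rw [e]
      have h1 := (abs_le.1 (hre (g t))).1
      have h2 := hg t ht
      have he := Real.exp_pos (μ * t)
      have hk2 : 0 < k ^ 2 := by nlinarith
      have h3 : 0 < k ^ 2 * ((l * a t).re - B * Real.exp (μ * t)) := mul_pos hk2 hp
      have h4 : 0 ≤ (B * (k ^ 2 - μ ^ 2) - G) * Real.exp (μ * t) :=
        mul_nonneg (by linarith) he.le
      nlinarith)
    (fun t => M * Real.exp (ν * t)) (by simpa using (exp_lin_tendsto ν hν).const_mul M)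
    (by
      intro t ht
      have h1 := (abs_le.1 (hre (a t))).2
      have h2 := hM t ht
      have : 0 ≤ B * Real.exp (μ * t) := by positivity
      linarith) t0 ht0
  simp only [hla] at key
  linarith

lemma ode_diff (c g : ℝ → ℂ) (ν μ G T : ℝ) (hν : ν < μ)
    (hc : ∀ t, HasDerivAt c (ν * c t + g t) t)
    (hg : ∀ t ≤ T, ‖g t‖ ≤ G * Real.exp (μ * t)) (s t : ℝ) (hst : s ≤ t) (ht : t ≤ T) (hG : 0 ≤ G) :
    ‖c t * (Real.exp (-ν * t) : ℝ) - c s * (Real.exp (-ν * s) : ℝ)‖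
      ≤ G / (μ - ν) * Real.exp ((μ - ν) * t) := by
  have hd : ∀ x, HasDerivAt (fun x => c x * (Real.exp (-ν * x) : ℝ)) (g x * (Real.exp (-ν * x) : ℝ)) x := by
    intro x
    have := (hc x).mul ((exp_lin_deriv (-ν) x).ofReal_comp)
    refine this.congr_deriv ?_
    push_cast; ring
  have hmn : 0 < μ - ν := by linarith
  have hB : ∀ x, HasDerivAt (fun x => G / (μ - ν) * (Real.exp ((μ - ν) * x) - Real.exp ((μ - ν) * s)))
      (G * Real.exp ((μ - ν) * x)) x := by
    intro x
    have := ((exp_lin_deriv (μ - ν) x).sub_const (Real.exp ((μ - ν) * s))).const_mul (G / (μ - ν))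
    refine this.congr_deriv ?_
    field_simp
  have := image_norm_le_of_norm_deriv_right_le_deriv_boundary (a := s) (b := t)
    (f := fun x => c x * (Real.exp (-ν * x) : ℝ) - c s * (Real.exp (-ν * s) : ℝ))
    (f' := fun x => g x * (Real.exp (-ν * x) : ℝ))
    (fun x hx => ((hd x).sub_const _).continuousAt.continuousWithinAt)
    (fun x hx => ((hd x).sub_const _).hasDerivWithinAt) (B := _) (B' := _) (by simp) hB
    (by
      intro x hx
      rw [norm_mul, Complex.norm_real, Real.norm_of_nonneg (Real.exp_pos _).le]
      calc _ ≤ G * Real.exp (μ * x) * Real.exp (-ν * x) := by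
            gcongr; exact hg x (by linarith [hx.2])
        _ = _ := by rw [mul_assoc, ← Real.exp_add]; congr 2; ring)
    (x := t) ⟨hst, le_rfl⟩
  refine this.trans ?_
  have : 0 ≤ G / (μ - ν) := by positivity
  gcongr
  linarith [Real.exp_pos ((μ - ν) * s)]

lemma exp_cancel (z : ℂ) (ν t : ℝ) :
    z = z * (Real.exp (-ν * t) : ℝ) * (Real.exp (ν * t) : ℝ) := by
  rw [mul_assoc, ← Complex.ofReal_mul, ← Real.exp_add]; simp

lemma ode_first (c g : ℝ → ℂ) (ν μ κ G M T : ℝ) (hν : ν < μ) (hκ : ν < κ)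
    (hc : ∀ t, HasDerivAt c (ν * c t + g t) t)
    (hg : ∀ t ≤ T, ‖g t‖ ≤ G * Real.exp (μ * t)) (hG : 0 ≤ G)
    (hM : ∀ t ≤ T, ‖c t‖ ≤ M * Real.exp (κ * t)) :
    ∀ t ≤ T, ‖c t‖ ≤ G / (μ - ν) * Real.exp (μ * t) := by
  intro t ht
  have h1 : Filter.Tendsto (fun s => c s * (Real.exp (-ν * s) : ℝ)) Filter.atBot (nhds 0) := by
    apply squeeze_zero_norm' (a := fun s => M * Real.exp ((κ - ν) * s))
    · filter_upwards [Filter.eventually_le_atBot T] with s hs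
      rw [norm_mul, Complex.norm_real, Real.norm_of_nonneg (Real.exp_pos _).le]
      calc _ ≤ M * Real.exp (κ * s) * Real.exp (-ν * s) := by gcongr; exact hM s hs
        _ = _ := by rw [mul_assoc, ← Real.exp_add]; congr 2; ring
    · simpa using (exp_lin_tendsto (κ - ν) (by linarith)).const_mul M
  have h2 : ‖c t * (Real.exp (-ν * t) : ℝ)‖ ≤ G / (μ - ν) * Real.exp ((μ - ν) * t) := by
    have h3 := (tendsto_const_nhds (x := c t * (Real.exp (-ν * t) : ℝ))).sub h1 |>.norm
    rw [sub_zero] at h3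
    refine le_of_tendsto h3 ?_
    filter_upwards [Filter.eventually_le_atBot t] with s hs
    exact ode_diff c g ν μ G T hν hc hg s t hs ht hG
  rw [exp_cancel (c t) ν t, norm_mul, Complex.norm_real, Real.norm_of_nonneg (Real.exp_pos _).le]
  calc _ ≤ G / (μ - ν) * Real.exp ((μ - ν) * t) * Real.exp (ν * t) := by gcongr
    _ = _ := by rw [mul_assoc, ← Real.exp_add]; congr 2; ring

lemma ode_limit (c g : ℝ → ℂ) (ν μ G T : ℝ) (hν : ν < μ)
    (hc : ∀ t, HasDerivAt c (ν * c t + g t) t)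
    (hg : ∀ t ≤ T, ‖g t‖ ≤ G * Real.exp (μ * t)) (hG : 0 ≤ G) :
    ∃ L : ℂ, ∀ t ≤ T, ‖c t - L * (Real.exp (ν * t) : ℝ)‖ ≤ G / (μ - ν) * Real.exp (μ * t) := by
  have hmn : 0 < μ - ν := by linarith
  have hT : Filter.Tendsto (fun n : ℕ => T - (n : ℝ)) Filter.atTop Filter.atBot := by
    simp only [sub_eq_add_neg]
    exact Filter.tendsto_atBot_add_const_left _ T
      (Filter.tendsto_neg_atTop_atBot.comp tendsto_natCast_atTop_atTop)
  have hcs : CauchySeq (fun n : ℕ => c (T - n) * (Real.exp (-ν * (T - n)) : ℝ)) := by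
    apply cauchySeq_of_le_tendsto_0' (fun n : ℕ => G / (μ - ν) * Real.exp ((μ - ν) * (T - n)))
    · intro n m hnm
      rw [dist_eq_norm]
      have : (n : ℝ) ≤ m := by exact_mod_cast hnm
      exact ode_diff c g ν μ G T hν hc hg (T - m) (T - n) (by linarith)
        (by have : (0 : ℝ) ≤ n := n.cast_nonneg
            linarith) hG
    · simpa using ((exp_lin_tendsto (μ - ν) hmn).comp hT).const_mul (G / (μ - ν))
  obtain ⟨L, hL⟩ := cauchySeq_tendsto_of_complete hcs
  refine ⟨L, fun t ht => ?_⟩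
  have h2 : ‖c t * (Real.exp (-ν * t) : ℝ) - L‖ ≤ G / (μ - ν) * Real.exp ((μ - ν) * t) := by
    have h3 := (tendsto_const_nhds (x := c t * (Real.exp (-ν * t) : ℝ))).sub hL |>.norm
    refine le_of_tendsto h3 ?_
    filter_upwards [hT.eventually (Filter.eventually_le_atBot t)] with n hn
    exact ode_diff c g ν μ G T hν hc hg (T - n) t hn ht hG
  have e : c t - L * (Real.exp (ν * t) : ℝ) =
      (c t * (Real.exp (-ν * t) : ℝ) - L) * (Real.exp (ν * t) : ℝ) := by
    rw [sub_mul, ← exp_cancel]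
  rw [e, norm_mul, Complex.norm_real, Real.norm_of_nonneg (Real.exp_pos _).le]
  calc _ ≤ G / (μ - ν) * Real.exp ((μ - ν) * t) * Real.exp (ν * t) := by gcongr
    _ = _ := by rw [mul_assoc, ← Real.exp_add]; congr 2; ring

lemma interp (a a1 a2 : ℝ → ℂ) (ν M M' T : ℝ) (hν : 0 ≤ ν)
    (ha : ∀ t, HasDerivAt a (a1 t) t) (ha1 : ∀ t, HasDerivAt a1 (a2 t) t)
    (hM0 : 0 ≤ M) (hM0' : 0 ≤ M')
    (hM : ∀ t ≤ T, ‖a t‖ ≤ M * Real.exp (ν * t))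
    (hM' : ∀ t ≤ T, ‖a2 t‖ ≤ M' * Real.exp (ν * t)) :
    ∀ t ≤ T, ‖a1 t‖ ≤ (2 * M + M') * Real.exp (ν * t) := by
  intro t ht
  have b1 : ∀ s ∈ Set.Icc (t - 1) t, ‖a1 s - a1 t‖ ≤ M' * Real.exp (ν * t) := by
    intro s hs
    have := (convex_Icc (t - 1) t).norm_image_sub_le_of_norm_hasDerivWithin_le (f := a1) (f' := a2)
      (C := M' * Real.exp (ν * t)) (x := t) (y := s)
      (fun x hx => (ha1 x).hasDerivWithinAt)
      (fun x hx => (hM' x (hx.2.trans ht)).trans (by gcongr; exact hx.2))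
      ⟨by linarith, le_rfl⟩ hs
    refine this.trans ?_
    have h1 : ‖s - t‖ ≤ 1 := by rw [Real.norm_eq_abs, abs_le]; constructor <;> linarith [hs.1, hs.2]
    have : 0 ≤ M' * Real.exp (ν * t) := by positivity
    nlinarith
  have b2 := (convex_Icc (t - 1) t).norm_image_sub_le_of_norm_hasDerivWithin_le
      (f := fun s => a s - s * a1 t) (f' := fun s => a1 s - a1 t)
      (C := M' * Real.exp (ν * t)) (x := t - 1) (y := t)
      (fun x hx => by
        have h1 : HasDerivAt (fun s : ℝ => (s : ℂ) * a1 t) (1 * a1 t) x :=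
          (Complex.ofRealCLM.hasDerivAt (x := x)).mul_const _ |>.congr_deriv (by simp)
        have h2 := ((ha x).sub h1)
        rw [one_mul] at h2
        exact h2.hasDerivWithinAt) b1
      ⟨le_rfl, by linarith⟩ ⟨by linarith, le_rfl⟩
  have e : a1 t = a t - a (t - 1) - ((a t - t * a1 t) - (a (t - 1) - ((t - 1 : ℝ) : ℂ) * a1 t)) := by
    push_cast; ring
  rw [e]
  have h1 := hM t ht
  have h2 : ‖a (t - 1)‖ ≤ M * Real.exp (ν * t) :=
    (hM (t - 1) (by linarith)).trans (by gcongr; linarith)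
  have h3 : ‖(a t - t * a1 t) - (a (t - 1) - ((t - 1 : ℝ) : ℂ) * a1 t)‖ ≤ M' * Real.exp (ν * t) := by
    simpa using b2
  calc _ ≤ ‖a t - a (t - 1)‖ + _ := norm_sub_le _ _
    _ ≤ ‖a t‖ + ‖a (t - 1)‖ + _ := by gcongr; exact norm_sub_le _ _
    _ ≤ _ := by linarith

lemma mode (a a1 g : ℝ → ℂ) (k : ℤ) (m : ℕ) (hm : 1 ≤ m) (G M T : ℝ)
    (ha : ∀ t, HasDerivAt a (a1 t) t)
    (ha1 : ∀ t, HasDerivAt a1 (((k : ℝ) ^ 2 : ℝ) * a t + g t) t)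
    (hg : ∀ t ≤ T, ‖g t‖ ≤ G * Real.exp ((m + 1 / 2) * t)) (hG : 0 ≤ G) (hM0 : 0 ≤ M)
    (hM : ∀ t ≤ T, ‖a t‖ ≤ M * Real.exp ((m - 1 / 2) * t)) :
    ∃ c : ℂ, (|k| ≠ m → c = 0) ∧ ∀ t ≤ T, ‖a t - c * (Real.exp (m * t) : ℝ)‖
      ≤ (‖a T‖ * Real.exp (-((m + 1 / 2) * T)) + G / |(k : ℝ) ^ 2 - (m + 1 / 2) ^ 2|)
        * Real.exp ((m + 1 / 2) * t) := by
  have hm1 : (1 : ℝ) ≤ m := by exact_mod_cast hm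
  set κ : ℝ := |(k : ℝ)| with hκ
  have hκ0 : 0 ≤ κ := abs_nonneg _
  have hk2 : (k : ℝ) ^ 2 = κ ^ 2 := (sq_abs _).symm
  have hκi : κ = ((|k| : ℤ) : ℝ) := by rw [hκ]; push_cast; rfl
  rw [hk2]
  rw [hk2] at ha1
  have hT0 : 0 ≤ ‖a T‖ * Real.exp (-((m + 1 / 2) * T)) := by positivity
  rcases lt_or_ge (m : ℤ) |k| with hlt | hle
  · have h1 : (m : ℝ) + 1 ≤ κ := by rw [hκi]; exact_mod_cast hlt
    refine ⟨0, fun _ => rfl, ?_⟩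
    have := ode_high a a1 g κ (m + 1 / 2) (m - 1 / 2) G M T (by linarith) (by linarith)
      (by linarith) ha ha1 hg hG hM
    rw [abs_of_pos (by nlinarith)]
    simpa using this
  have hκm : κ ≤ m := by rw [hκi]; exact_mod_cast hle
  have habs : |κ ^ 2 - ((m : ℝ) + 1 / 2) ^ 2| = (m + 1 / 2 - κ) * (m + 1 / 2 - -κ) := by
    rw [abs_of_neg (by nlinarith)]; ring
  rw [habs]
  have hd1 : 0 < (m : ℝ) + 1 / 2 - κ := by linarith
  have hd2 : 0 < (m : ℝ) + 1 / 2 - -κ := by linarith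
  have hc : ∀ t, HasDerivAt (fun s => a1 s + κ * a s) (κ * (a1 t + κ * a t) + g t) t := by
    intro t
    refine ((ha1 t).add ((ha t).const_mul (κ : ℂ))).congr_deriv ?_
    push_cast; ring
  have fin : ∀ x t : ℝ, x ≤ G / (m + 1 / 2 - κ) / (m + 1 / 2 - -κ) * Real.exp ((m + 1 / 2) * t) →
      x ≤ (‖a T‖ * Real.exp (-((m + 1 / 2) * T)) + G / ((m + 1 / 2 - κ) * (m + 1 / 2 - -κ)))
        * Real.exp ((m + 1 / 2) * t) := by
    intro x t hx
    refine hx.trans ?_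
    rw [div_div]
    gcongr
    linarith
  rcases hle.eq_or_lt with heq | hlt
  · -- |k| = m
    have hκm : κ = m := by rw [hκi]; exact_mod_cast heq
    obtain ⟨L, hL⟩ := ode_limit _ g κ (m + 1 / 2) G T (by linarith) hc hg hG
    have hm0 : (m : ℂ) ≠ 0 := by
      have : m ≠ 0 := by omega
      exact_mod_cast this
    refine ⟨L / (2 * m), fun h => absurd heq h, fun t ht => fin _ _ ?_⟩
    refine ode_first (fun t => a t - L / (2 * m) * (Real.exp (m * t) : ℝ))
      (fun t => (a1 t + κ * a t) - L * (Real.exp (κ * t) : ℝ)) (-κ) (m + 1 / 2) (m - 1 / 2)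
      (G / (m + 1 / 2 - κ)) (M + ‖L / (2 * m)‖ * Real.exp (1 / 2 * T)) T (by linarith) (by linarith)
      ?_ hL (by positivity) ?_ t ht
    · intro t
      refine ((ha t).sub (((exp_lin_deriv m t).ofReal_comp).const_mul (L / (2 * m)))).congr_deriv ?_
      rw [hκm]
      push_cast
      field_simp
      ring
    · intro t ht
      refine (norm_sub_le _ _).trans ?_
      rw [add_mul]
      refine add_le_add (hM t ht) ?_
      rw [norm_mul, Complex.norm_real, Real.norm_of_nonneg (Real.exp_pos _).le, mul_assoc,
        ← Real.exp_add]
      gcongr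
      linarith
  · have hκm1 : κ ≤ m - 1 := by
      rw [hκi]
      have : |k| ≤ (m : ℤ) - 1 := by omega
      exact_mod_cast this
    have ha1b := interp a a1 _ (m - 1 / 2) M (κ ^ 2 * M + G * Real.exp T) T (by linarith) ha ha1
      hM0 (by positivity) hM (by
        intro t ht
        refine (norm_add_le _ _).trans ?_
        rw [add_mul]
        refine add_le_add ?_ ?_
        · rw [norm_mul, Complex.norm_real, Real.norm_of_nonneg (by positivity), mul_assoc]
          gcongr
          exact hM t ht
        · refine (hg t ht).trans ?_
          rw [mul_assoc, ← Real.exp_add]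
          gcongr
          linarith)
    have hcb := ode_first _ g κ (m + 1 / 2) (m - 1 / 2) G
      ((2 * M + (κ ^ 2 * M + G * Real.exp T)) + κ * M) T (by linarith) (by linarith) hc hg hG (by
        intro t ht
        refine (norm_add_le _ _).trans ?_
        rw [add_mul]
        refine add_le_add (ha1b t ht) ?_
        rw [norm_mul, Complex.norm_real, Real.norm_of_nonneg hκ0, mul_assoc]
        gcongr
        exact hM t ht)
    refine ⟨0, fun _ => rfl, fun t ht => fin _ _ ?_⟩
    have := ode_first a (fun t => a1 t + κ * a t) (-κ) (m + 1 / 2) (m - 1 / 2)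
      (G / (m + 1 / 2 - κ)) M T (by linarith) (by linarith)
      (fun t => (ha t).congr_deriv (by push_cast; ring)) hcb (by positivity) hM t ht
    simpa using this

/-- Fourier coefficient of a `2π`-periodic real function. -/
noncomputable def coef (f : ℝ → ℝ) (k : ℤ) : ℂ :=
  (1 / (2 * π) : ℝ) * ∫ x in (0 : ℝ)..(2 * π), Complex.exp (-(k * x * Complex.I)) * (f x : ℂ)

lemma norm_ker (k : ℤ) (x : ℝ) : ‖Complex.exp (-(k * x * Complex.I))‖ = 1 := by
  have : -((k : ℂ) * x * Complex.I) = ((-(k * x) : ℝ) : ℂ) * Complex.I := by push_cast; ring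
  rw [this, Complex.norm_exp_ofReal_mul_I]

lemma coef_norm_le (f : ℝ → ℝ) (k : ℤ) (C : ℝ) (h : ∀ x, |f x| ≤ C) : ‖coef f k‖ ≤ C := by
  have hpi := Real.pi_pos
  unfold coef
  rw [norm_mul, Complex.norm_real, Real.norm_of_nonneg (by positivity)]
  have := intervalIntegral.norm_integral_le_of_norm_le_const (a := (0 : ℝ)) (b := 2 * π)
    (f := fun x : ℝ => Complex.exp (-(k * x * Complex.I)) * (f x : ℂ)) (C := C)
    (by intro x _; rw [norm_mul, norm_ker, one_mul, Complex.norm_real]; exact h x)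
  rw [sub_zero, abs_of_pos (by positivity)] at this
  calc _ ≤ 1 / (2 * π) * (C * (2 * π)) := by gcongr
    _ = C := by field_simp

lemma coef_sub (f g : ℝ → ℝ) (hf : Continuous f) (hg : Continuous g) (k : ℤ) :
    coef (fun x => f x - g x) k = coef f k - coef g k := by
  unfold coef
  rw [← mul_sub, ← intervalIntegral.integral_sub]
  · congr 1
    apply intervalIntegral.integral_congr
    intro x _
    simp only; push_cast; ring
  · exact Continuous.intervalIntegrable (by fun_prop) _ _
  · exact Continuous.intervalIntegrable (by fun_prop) _ _

lemma coef_deriv (F F' : ℝ → ℝ → ℝ) (hF : Continuous (Function.uncurry F))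
    (hF' : Continuous (Function.uncurry F'))
    (h : ∀ t x, HasDerivAt (fun s => F s x) (F' t x) t) (k : ℤ) (t : ℝ) :
    HasDerivAt (fun s => coef (F s) k) (coef (F' t) k) t := by
  unfold coef
  apply HasDerivAt.const_mul
  obtain ⟨C, hC⟩ := ((isCompact_Icc (a := t - 1) (b := t + 1)).prod
    (isCompact_Icc (a := (0 : ℝ)) (b := 2 * π))).exists_bound_of_continuousOn hF'.continuousOn
  have hFt : ∀ s, Continuous (F s) := fun s => hF.comp (Continuous.prodMk_right s)
  have hFt' : ∀ s, Continuous (F' s) := fun s => hF'.comp (Continuous.prodMk_right s)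
  have hpi := Real.pi_pos
  have := intervalIntegral.hasDerivAt_integral_of_dominated_loc_of_deriv_le (𝕜 := ℝ) (μ := volume)
    (F := fun s x => Complex.exp (-(k * x * Complex.I)) * (F s x : ℂ))
    (F' := fun s x => Complex.exp (-(k * x * Complex.I)) * (F' s x : ℂ))
    (x₀ := t) (s := Set.Icc (t - 1) (t + 1)) (a := 0) (b := 2 * π) (bound := fun _ => C)
    (Icc_mem_nhds (by linarith) (by linarith))
    (Filter.Eventually.of_forall fun s => by
      have := hFt s
      exact Continuous.aestronglyMeasurable (by fun_prop))
    (by have := hFt t; exact Continuous.intervalIntegrable (by fun_prop) _ _)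
    (by have := hFt' t; exact Continuous.aestronglyMeasurable (by fun_prop))
    (Filter.Eventually.of_forall fun x hx s hs => by
      rw [norm_mul, norm_ker, one_mul, Complex.norm_real]
      rw [Set.uIoc_of_le (by positivity)] at hx
      exact hC (s, x) ⟨hs, hx.1.le, hx.2⟩)
    (by simp)
    (Filter.Eventually.of_forall fun x hx s hs =>
      ((h s x).ofReal_comp).const_mul _)
  exact this.2

lemma ker_deriv (k : ℤ) (x : ℝ) :
    HasDerivAt (fun x : ℝ => Complex.exp (-(k * x * Complex.I)))
      (-(k * Complex.I) * Complex.exp (-(k * x * Complex.I))) x := by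
  have h1 : HasDerivAt (fun x : ℝ => -((k : ℂ) * x * Complex.I)) (-(k * Complex.I)) x := by
    exact (((Complex.ofRealCLM.hasDerivAt (x := x)).const_mul (k : ℂ)).mul_const Complex.I).neg.congr_deriv (by simp)
  exact h1.cexp.congr_deriv (by ring)

lemma ker_per (k : ℤ) : Complex.exp (-(k * ((2 * π : ℝ) : ℂ) * Complex.I)) = 1 := by
  rw [Complex.exp_eq_one_iff]
  exact ⟨-k, by push_cast; ring⟩

lemma coef_ibp (f f' : ℝ → ℝ) (hf : ∀ x, HasDerivAt f (f' x) x) (hf' : Continuous f')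
    (hper : f (2 * π) = f 0) (k : ℤ) : coef f' k = k * Complex.I * coef f k := by
  have hfc : Continuous f := continuous_iff_continuousAt.2 fun x => (hf x).continuousAt
  have := intervalIntegral.integral_mul_deriv_eq_deriv_mul (a := 0) (b := 2 * π)
    (u := fun x : ℝ => Complex.exp (-(k * x * Complex.I))) (v := fun x => (f x : ℂ))
    (u' := fun x : ℝ => -(k * Complex.I) * Complex.exp (-(k * x * Complex.I)))
    (v' := fun x => (f' x : ℂ)) (fun x _ => ker_deriv k x) (fun x _ => (hf x).ofReal_comp)
    (Continuous.intervalIntegrable (by fun_prop) _ _)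
    (Continuous.intervalIntegrable (by fun_prop) _ _)
  unfold coef
  rw [this, ker_per, hper]
  simp only [mul_assoc, intervalIntegral.integral_const_mul]
  simp
  ring

lemma coef_ibp2 (f f1 f2 : ℝ → ℝ) (hf : ∀ x, HasDerivAt f (f1 x) x)
    (hf1 : ∀ x, HasDerivAt f1 (f2 x) x) (hf2 : Continuous f2)
    (hper : f (2 * π) = f 0) (hper1 : f1 (2 * π) = f1 0) (k : ℤ) :
    coef f2 k = -((k : ℝ) ^ 2 : ℝ) * coef f k := by
  have hf1c : Continuous f1 := continuous_iff_continuousAt.2 fun x => (hf1 x).continuousAt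
  rw [coef_ibp f1 f2 hf1 hf2 hper1, coef_ibp f f1 hf hf1c hper]
  push_cast
  linear_combination (k : ℂ) ^ 2 * coef f k * Complex.I_sq

lemma coef_hasSum (f : ℝ → ℝ) (hf : Continuous f) (hper : Function.Periodic f (2 * π))
    (hs : Summable (fun k => ‖coef f k‖)) (x : ℝ) :
    HasSum (fun k : ℤ => coef f k * Complex.exp (k * x * Complex.I)) (f x : ℂ) := by
  have : Fact (0 < 2 * π) := ⟨by positivity⟩
  have hper' : Function.Periodic (fun x => (f x : ℂ)) (2 * π) := fun x => by simp [hper x]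
  have hcl : Continuous (hper'.lift : AddCircle (2 * π) → ℂ) := by
    refine (QuotientAddGroup.isQuotientMap_mk _).continuous_iff.2 ?_
    show Continuous fun x : ℝ => (f x : ℂ)
    fun_prop
  set F : C(AddCircle (2 * π), ℂ) := ⟨hper'.lift, hcl⟩ with hF
  have hco : ∀ k, fourierCoeff F k = coef f k := by
    intro k
    rw [fourierCoeff_eq_intervalIntegral F k 0]
    unfold coef
    rw [zero_add, Complex.real_smul]
    congr 1
    apply intervalIntegral.integral_congr
    intro x _
    simp only [smul_eq_mul]
    congr 1
    · rw [fourier_coe_apply]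
      congr 1
      have : (π : ℂ) ≠ 0 := by exact_mod_cast Real.pi_ne_zero
      push_cast
      field_simp
  have hsum : Summable (fourierCoeff F) := by
    rw [show (fourierCoeff F : ℤ → ℂ) = fun k => coef f k from funext hco]
    exact hs.of_norm
  have := has_pointwise_sum_fourier_series_of_summable hsum (x : AddCircle (2 * π))
  have hFx : F (x : AddCircle (2 * π)) = (f x : ℂ) := rfl
  rw [hFx] at this
  convert this using 1
  funext k
  rw [hco, smul_eq_mul, fourier_coe_apply]
  congr 2
  have : (π : ℂ) ≠ 0 := by exact_mod_cast Real.pi_ne_zero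
  push_cast
  field_simp

/-- comparison sequence -/
noncomputable def hsq (k : ℤ) : ℝ := 1 / (|(k : ℝ)| - 1 / 2) ^ 2

lemma hsq_nonneg (k : ℤ) : 0 ≤ hsq k := by unfold hsq; positivity

lemma hsq_summable : Summable hsq := by
  have h := (Real.summable_one_div_int_pow (p := 2)).2 one_lt_two |>.mul_left 4
  refine Summable.of_norm_bounded_eventually h ?_
  filter_upwards [(Set.finite_singleton (0 : ℤ)).compl_mem_cofinite] with k hk
  have hk0 : k ≠ 0 := by simpa using hk
  have h1 : (1 : ℝ) ≤ |(k : ℝ)| := by exact_mod_cast Int.one_le_abs hk0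
  rw [Real.norm_of_nonneg (hsq_nonneg k), hsq, mul_one_div, ← sq_abs (k : ℝ),
    div_le_div_iff₀ (by nlinarith) (by nlinarith)]
  nlinarith

noncomputable def C0 : ℝ := 2 * ∑' k, hsq k

lemma C0_nonneg : 0 ≤ C0 := by
  unfold C0
  have : 0 ≤ ∑' k, hsq k := tsum_nonneg hsq_nonneg
  linarith

lemma hsq_shift (m : ℕ) (k : ℤ) :
    1 / |(k : ℝ) ^ 2 - (m + 1 / 2) ^ 2| ≤ hsq (k - m) + hsq (k + m) := by
  have half : ∀ j : ℤ, 0 < (|(j : ℝ)| - 1 / 2) ^ 2 := by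
    intro j
    rcases eq_or_ne j 0 with rfl | hj
    · norm_num
    · have h1 : (1 : ℝ) ≤ |(j : ℝ)| := by exact_mod_cast Int.one_le_abs hj
      nlinarith
  have hm0 : (0 : ℝ) ≤ m := m.cast_nonneg
  rcases le_total 0 k with hk | hk
  · have hk' : (0 : ℝ) ≤ k := by exact_mod_cast hk
    have h1 : 1 / |(k : ℝ) ^ 2 - (m + 1 / 2) ^ 2| ≤ hsq (k - m) := by
      unfold hsq
      apply one_div_le_one_div_of_le (half _)
      push_cast
      rcases le_or_gt k (m : ℤ) with h | h
      · have h' : (k : ℝ) ≤ m := by exact_mod_cast h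
        rw [abs_of_nonpos (sub_nonpos.2 h'), abs_of_nonpos (by nlinarith)]
        nlinarith
      · have h' : (m : ℝ) + 1 ≤ k := by exact_mod_cast h
        rw [abs_of_nonneg (by linarith), abs_of_nonneg (by nlinarith)]
        nlinarith
    linarith [hsq_nonneg (k + m)]
  · have hk' : (k : ℝ) ≤ 0 := by exact_mod_cast hk
    have h1 : 1 / |(k : ℝ) ^ 2 - (m + 1 / 2) ^ 2| ≤ hsq (k + m) := by
      unfold hsq
      apply one_div_le_one_div_of_le (half _)
      push_cast
      rcases le_or_gt (-k) (m : ℤ) with h | h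
      · have h' : -(k : ℝ) ≤ m := by exact_mod_cast h
        rw [abs_of_nonneg (by linarith), abs_of_nonpos (by nlinarith)]
        nlinarith
      · have h' : (m : ℝ) + 1 ≤ -k := by exact_mod_cast h
        rw [abs_of_nonpos (by linarith), abs_of_nonneg (by nlinarith)]
        nlinarith
    linarith [hsq_nonneg (k - m)]

lemma shift_hasSum (m : ℕ) : HasSum (fun k : ℤ => hsq (k - m) + hsq (k + m)) C0 := by
  have h := hsq_summable.hasSum
  have h1 : HasSum (fun k : ℤ => hsq (k - m)) (∑' k, hsq k) :=
    (Equiv.hasSum_iff (f := hsq) (Equiv.subRight (m : ℤ))).2 h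
  have h2 : HasSum (fun k : ℤ => hsq (k + m)) (∑' k, hsq k) :=
    (Equiv.hasSum_iff (f := hsq) (Equiv.addRight (m : ℤ))).2 h
  have := h1.add h2
  rwa [← two_mul] at this

/-- A `C²` function on the cylinder with Laplacian `g`. -/
structure Cyl (u ut utt ux uxx g : ℝ → ℝ → ℝ) : Prop where
  cu : Continuous (Function.uncurry u)
  cut : Continuous (Function.uncurry ut)
  cutt : Continuous (Function.uncurry utt)
  cuxx : Continuous (Function.uncurry uxx)
  dt : ∀ t x, HasDerivAt (fun s => u s x) (ut t x) t
  dtt : ∀ t x, HasDerivAt (fun s => ut s x) (utt t x) t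
  dx : ∀ t x, HasDerivAt (u t) (ux t x) x
  dxx : ∀ t x, HasDerivAt (ux t) (uxx t x) x
  per : ∀ t, Function.Periodic (u t) (2 * π)
  perx : ∀ t, ux t (2 * π) = ux t 0
  lap : ∀ t x, utt t x + uxx t x = g t x

lemma cont_slice {F : ℝ → ℝ → ℝ} (hF : Continuous (Function.uncurry F)) (t : ℝ) :
    Continuous (F t) := hF.comp (Continuous.prodMk_right t)

lemma Cyl.coef_uxx {u ut utt ux uxx g : ℝ → ℝ → ℝ} (h : Cyl u ut utt ux uxx g) (t : ℝ) (k : ℤ) :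
    coef (uxx t) k = -((k : ℝ) ^ 2 : ℝ) * coef (u t) k :=
  coef_ibp2 (u t) (ux t) (uxx t) (h.dx t) (h.dxx t) (cont_slice h.cuxx t)
    (by have := h.per t 0; simpa using this) (h.perx t) k

lemma Cyl.summable {u ut utt ux uxx g : ℝ → ℝ → ℝ} (h : Cyl u ut utt ux uxx g) (t : ℝ) :
    Summable (fun k => ‖coef (u t) k‖) := by
  have bdd : ∀ F : ℝ → ℝ → ℝ, Continuous (Function.uncurry F) → ∃ C, 0 ≤ C ∧
      ∀ k, ‖coef (F t) k‖ ≤ C := by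
    intro F hF
    obtain ⟨C, hC⟩ := (isCompact_Icc (a := (0 : ℝ)) (b := 2 * π)).exists_bound_of_continuousOn
      (cont_slice hF t).continuousOn
    refine ⟨|C|, abs_nonneg _, fun k => ?_⟩
    have hpi := Real.pi_pos
    unfold coef
    rw [norm_mul, Complex.norm_real, Real.norm_of_nonneg (by positivity)]
    have := intervalIntegral.norm_integral_le_of_norm_le_const (a := (0 : ℝ)) (b := 2 * π)
      (f := fun x : ℝ => Complex.exp (-(k * x * Complex.I)) * (F t x : ℂ)) (C := |C|)
      (by
        intro x hx
        rw [Set.uIoc_of_le (by positivity)] at hx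
        rw [norm_mul, norm_ker, one_mul, Complex.norm_real]
        exact (hC x ⟨hx.1.le, hx.2⟩).trans (le_abs_self _))
    rw [sub_zero, abs_of_pos (by positivity : 0 < 2 * π)] at this
    calc _ ≤ 1 / (2 * π) * (|C| * (2 * π)) := by gcongr
      _ = |C| := by field_simp
  obtain ⟨C1, hC1, b1⟩ := bdd u h.cu
  obtain ⟨C2, hC2, b2⟩ := bdd uxx h.cuxx
  refine Summable.of_nonneg_of_le (fun _ => norm_nonneg _) (fun k => ?_)
    (hsq_summable.mul_left (C1 + C2))
  unfold hsq
  rcases eq_or_ne k 0 with rfl | hk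
  · have := b1 0
    norm_num
    linarith
  · have h1 : (1 : ℝ) ≤ |(k : ℝ)| := by exact_mod_cast Int.one_le_abs hk
    have h2 := b2 k
    rw [h.coef_uxx, norm_mul, norm_neg, Complex.norm_real, Real.norm_of_nonneg (by positivity),
      ← sq_abs] at h2
    rw [mul_one_div, le_div_iff₀ (by nlinarith)]
    have h3 : (|(k : ℝ)| - 1 / 2) ^ 2 ≤ |(k : ℝ)| ^ 2 := by nlinarith
    calc _ ≤ ‖coef (u t) k‖ * |(k : ℝ)| ^ 2 := by gcongr
      _ ≤ _ := by nlinarith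

noncomputable def SS (u : ℝ → ℝ → ℝ) (T : ℝ) : ℝ := ∑' k, ‖coef (u T) k‖

theorem Cyl.step {u ut utt ux uxx g : ℝ → ℝ → ℝ} (h : Cyl u ut utt ux uxx g) (m : ℕ) (hm : 1 ≤ m)
    (M G T : ℝ) (hM0 : 0 ≤ M) (hG : 0 ≤ G)
    (hu : ∀ t ≤ T, ∀ x, |u t x| ≤ M * Real.exp ((m - 1 / 2) * t))
    (hg : ∀ t ≤ T, ∀ x, |g t x| ≤ G * Real.exp ((m + 1 / 2) * t)) :
    ∃ α : ℂ, ∀ t ≤ T, ∀ x, |u t x - Real.exp (m * t) * (α * Complex.exp (m * x * Complex.I)).re|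
      ≤ (SS u T * Real.exp (-((m + 1 / 2) * T)) + G * C0) * Real.exp ((m + 1 / 2) * t) := by
  have hmode : ∀ k : ℤ, ∃ c : ℂ, (|k| ≠ m → c = 0) ∧ ∀ t ≤ T,
      ‖coef (u t) k - c * (Real.exp (m * t) : ℝ)‖
      ≤ (‖coef (u T) k‖ * Real.exp (-((m + 1 / 2) * T)) + G / |(k : ℝ) ^ 2 - (m + 1 / 2) ^ 2|)
        * Real.exp ((m + 1 / 2) * t) := by
    intro k
    refine mode (fun t => coef (u t) k) (fun t => coef (ut t) k) (fun t => coef (g t) k) k m hm G M T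
      (coef_deriv u ut h.cu h.cut h.dt k) ?_ (fun t ht => coef_norm_le _ _ _ (hg t ht)) hG hM0
      (fun t ht => coef_norm_le _ _ _ (hu t ht))
    intro t
    refine (coef_deriv ut utt h.cut h.cutt h.dtt k t).congr_deriv ?_
    have hge : utt t = fun x => g t x - uxx t x := by
      funext x; have := h.lap t x; linarith
    have hgc : Continuous (g t) := by
      have : g t = fun x => utt t x + uxx t x := by funext x; exact (h.lap t x).symm
      rw [this]
      exact (cont_slice h.cutt t).add (cont_slice h.cuxx t)
    rw [hge, coef_sub _ _ hgc (cont_slice h.cuxx t), h.coef_uxx]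
    ring
  choose c hc0 hc using hmode
  refine ⟨c m + (starRingEnd ℂ) (c (-m)), fun t ht x => ?_⟩
  have hm0 : (m : ℤ) ≠ -m := by omega
  have s1 := coef_hasSum (u t) (cont_slice h.cu t) (h.per t) (h.summable t) x
  have s2 : HasSum (fun k : ℤ => c k * (Real.exp (m * t) : ℝ) * Complex.exp (k * x * Complex.I))
      (∑ k ∈ ({(m : ℤ), -(m : ℤ)} : Finset ℤ),
        c k * (Real.exp (m * t) : ℝ) * Complex.exp (k * x * Complex.I)) := by
    apply hasSum_sum_of_ne_finset_zero
    intro k hk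
    have : |k| ≠ m := by
      intro h'
      apply hk
      rcases abs_choice k with h'' | h'' <;> simp <;> omega
    rw [hc0 k this]; simp
  rw [Finset.sum_pair hm0] at s2
  have s3 := s1.sub s2
  have s4 : HasSum (fun k : ℤ => (‖coef (u T) k‖ * Real.exp (-((m + 1 / 2) * T))
      + G * (hsq (k - m) + hsq (k + m))) * Real.exp ((m + 1 / 2) * t))
      ((SS u T * Real.exp (-((m + 1 / 2) * T)) + G * C0) * Real.exp ((m + 1 / 2) * t)) :=
    (((h.summable T).hasSum.mul_right _).add ((shift_hasSum m).mul_left G)).mul_right _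
  have key := tsum_of_norm_bounded s4 (f := fun k : ℤ => coef (u t) k * Complex.exp (k * x * Complex.I)
      - c k * (Real.exp (m * t) : ℝ) * Complex.exp (k * x * Complex.I)) (by
    intro k
    rw [← sub_mul, norm_mul]
    have : ‖Complex.exp (k * x * Complex.I)‖ = 1 := by
      have : ((k : ℂ) * x * Complex.I) = ((k * x : ℝ) : ℂ) * Complex.I := by push_cast; ring
      rw [this, Complex.norm_exp_ofReal_mul_I]
    rw [this, mul_one]
    refine (hc k t ht).trans ?_
    gcongr
    rw [div_eq_mul_one_div]
    gcongr
    exact hsq_shift m k)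
  rw [s3.tsum_eq] at key
  refine le_trans ?_ ((Complex.abs_re_le_norm _).trans key)
  apply le_of_eq
  congr 1
  have e1 : Complex.exp (((-(m : ℤ) : ℤ) : ℂ) * x * Complex.I)
      = (starRingEnd ℂ) (Complex.exp (m * x * Complex.I)) := by
    rw [← Complex.exp_conj]; congr 1; simp
  rw [e1]
  simp only [Complex.sub_re, Complex.add_re, Complex.mul_re, Complex.mul_im, Complex.ofReal_re,
    Complex.ofReal_im, Complex.conj_re, Complex.conj_im, Int.cast_natCast, Complex.add_im]
  ring

/-- If the leading coefficient is negligible it is zero. -/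
lemma alpha_zero (α : ℂ) (m : ℕ) (hm : 1 ≤ m) (C T : ℝ)
    (h : ∀ t ≤ T, ∀ x : ℝ, |Real.exp (m * t) * (α * Complex.exp (m * x * Complex.I)).re|
      ≤ C * Real.exp ((m + 1 / 2) * t)) : α = 0 := by
  have hm0 : (m : ℝ) ≠ 0 := by positivity
  have hb : ∀ t ≤ T, ‖α‖ ≤ C * Real.exp (1 / 2 * t) := by
    intro t ht
    have h1 := h t ht (-Complex.arg α / m)
    have e : α * Complex.exp (m * ((-Complex.arg α / m : ℝ) : ℂ) * Complex.I) = (‖α‖ : ℂ) := by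
      have : (m : ℂ) * ((-Complex.arg α / m : ℝ) : ℂ) * Complex.I = -(Complex.arg α * Complex.I) := by
        have : (m : ℂ) ≠ 0 := by exact_mod_cast hm0
        push_cast; field_simp
      rw [this]
      conv_lhs => rw [← Complex.norm_mul_exp_arg_mul_I α]
      rw [mul_assoc, Complex.norm_mul_exp_arg_mul_I, ← Complex.exp_add]; simp
    rw [e, Complex.ofReal_re, abs_of_nonneg (by positivity), add_mul, Real.exp_add] at h1
    have := Real.exp_pos (m * t)
    have h2 : Real.exp (m * t) * ‖α‖ ≤ Real.exp (m * t) * (C * Real.exp (1 / 2 * t)) := by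
      linarith
    exact le_of_mul_le_mul_left h2 this
  have hlim : Filter.Tendsto (fun t : ℝ => C * Real.exp (1 / 2 * t)) Filter.atBot (nhds 0) := by
    simpa using (exp_lin_tendsto (1 / 2) (by norm_num)).const_mul C
  have := ge_of_tendsto hlim (Filter.eventually_atBot.2 ⟨T, hb⟩)
  exact norm_le_zero_iff.1 this

theorem Cyl.sucp {u ut utt ux uxx g : ℝ → ℝ → ℝ} (h : Cyl u ut utt ux uxx g) (C T : ℝ)
    (hC : 0 ≤ C) (hT : C0 * C * Real.exp (2 * T) ≤ 1 / 2)
    (hg : ∀ t ≤ T, ∀ x, |g t x| ≤ C * Real.exp (2 * t) * |u t x|)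
    (hu : ∀ m : ℕ, 1 ≤ m → ∃ M, 0 ≤ M ∧ ∀ t ≤ T, ∀ x, |u t x| ≤ M * Real.exp ((m - 1 / 2) * t)) :
    ∀ t < T, ∀ x, u t x = 0 := by
  have hS : 0 ≤ SS u T := tsum_nonneg fun _ => norm_nonneg _
  have improve : ∀ m : ℕ, 1 ≤ m → ∀ M, 0 ≤ M →
      (∀ t ≤ T, ∀ x, |u t x| ≤ M * Real.exp ((m + 1 / 2) * t)) →
      ∀ t ≤ T, ∀ x, |u t x| ≤ (SS u T * Real.exp (-((m + 1 / 2) * T)) + M / 2)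
        * Real.exp ((m + 1 / 2) * t) := by
    intro m hm M hM hb
    obtain ⟨M', hM'0, hM'⟩ := hu m hm
    obtain ⟨α, hα⟩ := h.step m hm M' (C * Real.exp (2 * T) * M) T hM'0 (by positivity) hM' (by
      intro t ht x
      refine (hg t ht x).trans ?_
      rw [mul_assoc _ M]
      gcongr
      exact hb t ht x)
    have hα0 : α = 0 := by
      apply alpha_zero α m hm (M + (SS u T * Real.exp (-((m + 1 / 2) * T))
        + C * Real.exp (2 * T) * M * C0)) T
      intro t ht x
      have h1 := hb t ht x
      have h2 := hα t ht x
      rw [add_mul]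
      rw [abs_le] at *
      constructor <;> linarith [h1.1, h1.2, h2.1, h2.2]
    subst hα0
    intro t ht x
    have h2 := hα t ht x
    simp only [zero_mul, Complex.zero_re, mul_zero, sub_zero] at h2
    refine h2.trans ?_
    gcongr
    nlinarith
  have iter : ∀ m : ℕ, 1 ≤ m → ∀ t ≤ T, ∀ x, |u t x| ≤ 2 * SS u T * Real.exp ((m + 1 / 2) * (t - T)) := by
    intro m hm
    obtain ⟨M, hM0, hM⟩ := hu (m + 1) (by omega)
    have hj : ∀ j : ℕ, ∀ t ≤ T, ∀ x, |u t x| ≤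
        (2 * (SS u T * Real.exp (-((m + 1 / 2) * T))) + M * (1 / 2) ^ j) * Real.exp ((m + 1 / 2) * t) := by
      intro j
      induction j with
      | zero =>
        intro t ht x
        have h1 := hM t ht x
        have e : (((m + 1 : ℕ) : ℝ) - 1 / 2) * t = (m + 1 / 2) * t := by push_cast; ring
        rw [e] at h1
        refine h1.trans ?_
        gcongr
        have : 0 ≤ SS u T * Real.exp (-((m + 1 / 2) * T)) := by positivity
        simp; linarith
      | succ j ih =>
        intro t ht x
        refine (improve m hm _ (by positivity) ih t ht x).trans (le_of_eq ?_)
        ring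
    intro t ht x
    have lim : Filter.Tendsto (fun j : ℕ => (2 * (SS u T * Real.exp (-((m + 1 / 2) * T)))
        + M * (1 / 2) ^ j) * Real.exp ((m + 1 / 2) * t)) Filter.atTop
        (nhds ((2 * (SS u T * Real.exp (-((m + 1 / 2) * T))) + M * 0) * Real.exp ((m + 1 / 2) * t))) := by
      apply Filter.Tendsto.mul_const
      apply Filter.Tendsto.const_add
      apply Filter.Tendsto.const_mul
      exact tendsto_pow_atTop_nhds_zero_of_lt_one (by norm_num) (by norm_num)
    have := ge_of_tendsto' lim (fun j => hj j t ht x)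
    refine this.trans (le_of_eq ?_)
    rw [mul_zero, add_zero, mul_sub, sub_eq_add_neg, Real.exp_add]
    ring
  intro t ht x
  have lim : Filter.Tendsto (fun m : ℕ => 2 * SS u T * Real.exp (((m : ℝ) + 1 / 2) * (t - T)))
      Filter.atTop (nhds (2 * SS u T * 0)) := by
    apply Filter.Tendsto.const_mul
    apply Real.tendsto_exp_atBot.comp
    apply Filter.Tendsto.atTop_mul_const_of_neg (by linarith)
    exact Filter.tendsto_atTop_add_const_right _ _ tendsto_natCast_atTop_atTop
  have := ge_of_tendsto lim (Filter.eventually_atTop.2 ⟨1, fun m hm => iter m hm t ht.le x⟩)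
  rw [mul_zero] at this
  exact abs_nonpos_iff.1 this

noncomputable def e0 : E2 := EuclideanSpace.single 0 1
noncomputable def e1 : E2 := EuclideanSpace.single 1 1

noncomputable def gam (t x : ℝ) : E2 := (exp t * cos x) • e0 + (exp t * sin x) • e1
noncomputable def jam (t x : ℝ) : E2 := (-(exp t * sin x)) • e0 + (exp t * cos x) • e1

lemma pol_eq (t x : ℝ) : pol (exp t) x = gam t x := by
  ext i; fin_cases i <;> simp [pol, gam, e0, e1]

lemma gam_norm (t x : ℝ) : ‖gam t x‖ = exp t := by
  rw [← pol_eq, EuclideanSpace.norm_eq]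
  simp only [pol, Fin.sum_univ_two]
  rw [Real.sqrt_eq_iff_mul_self_eq_of_pos (exp_pos t)]
  simp [mul_pow]
  linear_combination (-(exp t)^2) * sin_sq_add_cos_sq x

lemma exists_gam (y : E2) (hy : y ≠ 0) : ∃ t x, y = gam t x ∧ exp t = ‖y‖ := by
  have hn : toC y ≠ 0 := by
    intro h; apply hy; apply toC_inj; rw [h]; simp [toC]; rfl
  have hp : 0 < ‖toC y‖ := norm_pos_iff.2 hn
  have e : y = gam (Real.log ‖toC y‖) (Complex.arg (toC y)) := by
    rw [← pol_eq]; apply toC_inj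
    rw [toC_pol, Real.exp_log hp, Complex.norm_mul_exp_arg_mul_I]
  refine ⟨_, _, e, ?_⟩
  rw [← gam_norm _ (Complex.arg (toC y)), ← e]

lemma gam_dt (t x : ℝ) : HasDerivAt (fun s => gam s x) (gam t x) t := by
  unfold gam
  exact (((Real.hasDerivAt_exp t).mul_const _).smul_const _).add
    (((Real.hasDerivAt_exp t).mul_const _).smul_const _)

lemma jam_dt (t x : ℝ) : HasDerivAt (fun s => jam s x) (jam t x) t := by
  unfold jam
  exact (((Real.hasDerivAt_exp t).mul_const _).neg.smul_const _).add
    (((Real.hasDerivAt_exp t).mul_const _).smul_const _)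

lemma gam_dx (t x : ℝ) : HasDerivAt (gam t) (jam t x) x := by
  have := (((Real.hasDerivAt_cos x).const_mul (exp t)).smul_const e0).add
    (((Real.hasDerivAt_sin x).const_mul (exp t)).smul_const e1)
  simp only [mul_neg] at this
  exact this

lemma jam_dx (t x : ℝ) : HasDerivAt (jam t) (-gam t x) x := by
  have := (((Real.hasDerivAt_sin x).const_mul (exp t)).neg.smul_const e0).add
    (((Real.hasDerivAt_cos x).const_mul (exp t)).smul_const e1)
  have e : -gam t x = -(exp t * cos x) • e0 + (exp t * -sin x) • e1 := by
    unfold gam; module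
  rw [e]
  exact this

lemma gam_cont : Continuous (fun q : ℝ × ℝ => gam q.1 q.2) := by unfold gam; fun_prop
lemma jam_cont : Continuous (fun q : ℝ × ℝ => jam q.1 q.2) := by unfold jam; fun_prop

lemma gam_per (t : ℝ) : Function.Periodic (gam t) (2 * π) := by intro x; simp [gam]

lemma lap_eq (φ : E2 → ℝ) (hφ : ContDiff ℝ 2 φ) (y : E2) :
    planeLaplacian φ y = fderiv ℝ (fderiv ℝ φ) y e0 e0 + fderiv ℝ (fderiv ℝ φ) y e1 e1 := by
  have h1 : ContDiff ℝ 1 (fderiv ℝ φ) := hφ.fderiv_right (by norm_num)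
  have h2 : DifferentiableAt ℝ (fderiv ℝ φ) y := (h1.differentiable (by norm_num)) y
  have key : ∀ v : E2, fderiv ℝ (fun z => fderiv ℝ φ z v) y v = fderiv ℝ (fderiv ℝ φ) y v v := by
    intro v
    have := h2.hasFDerivAt.clm_apply (hasFDerivAt_const v y)
    rw [this.fderiv]; simp
  simp only [planeLaplacian, Fin.sum_univ_two, key]
  rfl

lemma polar_cyl (φ K : E2 → ℝ) (hφ : ContDiff ℝ 2 φ)
    (hpde : ∀ y, planeLaplacian φ y + K y * φ y = 0) (p : E2) :
    Cyl (fun t x => φ (p + gam t x))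
      (fun t x => fderiv ℝ φ (p + gam t x) (gam t x))
      (fun t x => fderiv ℝ (fderiv ℝ φ) (p + gam t x) (gam t x) (gam t x)
        + fderiv ℝ φ (p + gam t x) (gam t x))
      (fun t x => fderiv ℝ φ (p + gam t x) (jam t x))
      (fun t x => fderiv ℝ (fderiv ℝ φ) (p + gam t x) (jam t x) (jam t x)
        + fderiv ℝ φ (p + gam t x) (-gam t x))
      (fun t x => -(exp (2 * t) * (K (p + gam t x) * φ (p + gam t x)))) := by
  have h1 : ContDiff ℝ 1 (fderiv ℝ φ) := hφ.fderiv_right (by norm_num)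
  have d1 : ∀ y, HasFDerivAt φ (fderiv ℝ φ y) y := fun y =>
    ((hφ.differentiable (by norm_num)) y).hasFDerivAt
  have d2 : ∀ y, HasFDerivAt (fderiv ℝ φ) (fderiv ℝ (fderiv ℝ φ) y) y := fun y =>
    ((h1.differentiable (by norm_num)) y).hasFDerivAt
  have c0 : Continuous φ := hφ.continuous
  have c1 : Continuous (fderiv ℝ φ) := h1.continuous
  have c2 : Continuous (fderiv ℝ (fderiv ℝ φ)) := h1.continuous_fderiv (by norm_num)
  have cg := gam_cont
  have cj := jam_cont
  have cp : Continuous (fun q : ℝ × ℝ => p + gam q.1 q.2) := continuous_const.add cg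
  have D1 : Continuous (fun q : ℝ × ℝ => fderiv ℝ φ (p + gam q.1 q.2)) := c1.comp cp
  have D2 : Continuous (fun q : ℝ × ℝ => fderiv ℝ (fderiv ℝ φ) (p + gam q.1 q.2)) := c2.comp cp
  refine ⟨c0.comp cp, D1.clm_apply cg, ((D2.clm_apply cg).clm_apply cg).add (D1.clm_apply cg),
    ((D2.clm_apply cj).clm_apply cj).add (D1.clm_apply cg.neg), ?_, ?_, ?_, ?_, ?_, ?_, ?_⟩
  · intro t x
    exact (d1 _).comp_hasDerivAt t ((gam_dt t x).const_add p)
  · intro t x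
    exact ((d2 _).comp_hasDerivAt t ((gam_dt t x).const_add p)).clm_apply (gam_dt t x)
  · intro t x
    exact (d1 _).comp_hasDerivAt x ((gam_dx t x).const_add p)
  · intro t x
    exact ((d2 _).comp_hasDerivAt x ((gam_dx t x).const_add p)).clm_apply (jam_dx t x)
  · intro t x
    simp only [gam_per t x]
  · intro t
    simp [gam, jam]
  · intro t x
    have hp := hpde (p + gam t x)
    rw [lap_eq φ hφ] at hp
    have : ∀ B : E2 →L[ℝ] E2 →L[ℝ] ℝ, B (gam t x) (gam t x) + B (jam t x) (jam t x)
        = exp (2 * t) * (B e0 e0 + B e1 e1) := by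
      intro B
      have ee : exp (2 * t) = exp t * exp t := by rw [← exp_add]; ring_nf
      simp only [gam, jam, map_add, map_smul, add_apply, smul_apply, smul_eq_mul, ee]
      linear_combination (exp t * exp t) * (B e0 e0 + B e1 e1) * sin_sq_add_cos_sq x
    have h3 := this (fderiv ℝ (fderiv ℝ φ) (p + gam t x))
    simp only [map_neg]
    linear_combination h3 + exp (2 * t) * hp

lemma exists_T (C : ℝ) : ∃ T ≤ 0, C0 * C * exp (2 * T) ≤ 1 / 2 := by
  have h := (exp_lin_tendsto 2 (by norm_num)).const_mul (C0 * C)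
  rw [mul_zero] at h
  have h1 := h.eventually (gt_mem_nhds (show (0:ℝ) < 1 / 2 by norm_num))
  obtain ⟨T, hT, hT0⟩ := (h1.and (Filter.eventually_le_atBot (0:ℝ))).exists
  exact ⟨T, hT0, hT.le⟩

lemma g_bound (φ K : E2 → ℝ) (q : E2) (C T : ℝ)
    (hK : ∀ y, ‖y - q‖ ≤ exp T → |K y| ≤ C) : ∀ t ≤ T, ∀ x,
    |(-(exp (2 * t) * (K (q + gam t x) * φ (q + gam t x))))|
      ≤ C * exp (2 * t) * |φ (q + gam t x)| := by
  intro t ht x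
  have h1 := hK (q + gam t x) (by simpa [gam_norm] using ht)
  rw [abs_neg, abs_mul, abs_mul, abs_of_pos (exp_pos _)]
  have := mul_le_mul_of_nonneg_left (mul_le_mul_of_nonneg_right h1 (abs_nonneg (φ (q + gam t x))))
    (exp_pos (2 * t)).le
  linarith

lemma sucp_ball (φ K : E2 → ℝ) (hφ : ContDiff ℝ 2 φ)
    (hpde : ∀ y, planeLaplacian φ y + K y * φ y = 0) (q : E2) (C T : ℝ)
    (hC : 0 ≤ C) (hT : C0 * C * exp (2 * T) ≤ 1 / 2)
    (hK : ∀ y, ‖y - q‖ ≤ exp T → |K y| ≤ C) (hq : φ q = 0)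
    (hu : ∀ m : ℕ, 1 ≤ m → ∃ M, 0 ≤ M ∧ ∀ t ≤ T, ∀ x,
      |φ (q + gam t x)| ≤ M * Real.exp ((m - 1 / 2) * t)) :
    ∀ y, ‖y - q‖ < exp T → φ y = 0 := by
  intro y hy
  have h := (polar_cyl φ K hφ hpde q).sucp C T hC hT (g_bound φ K q C T hK) hu
  by_cases hyq : y - q = 0
  · rw [sub_eq_zero.1 hyq, hq]
  · obtain ⟨t, x, e, ht⟩ := exists_gam _ hyq
    rw [← ht] at hy
    have := h t (exp_lt_exp.1 hy) x
    simp only [← e] at this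
    simpa using this

lemma K_bound (K : E2 → ℝ) (hK : Continuous K) (p : E2) (r : ℝ) :
    ∃ C, 0 ≤ C ∧ ∀ y, ‖y - p‖ ≤ r → |K y| ≤ C := by
  obtain ⟨C, hC⟩ := (isCompact_closedBall p r).exists_bound_of_continuousOn hK.continuousOn
  refine ⟨max C 0, le_max_right _ _, fun y hy => le_max_of_le_left ?_⟩
  exact hC y (by simpa [dist_eq_norm] using hy)

lemma ucp (φ K : E2 → ℝ) (hK : Continuous K) (hφ : ContDiff ℝ 2 φ)
    (hpde : ∀ y, planeLaplacian φ y + K y * φ y = 0)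
    (hne : (interior {y | φ y = 0}).Nonempty) : ∀ y, φ y = 0 := by
  have hcl : IsClosed (interior {y | φ y = 0}) := by
    apply isClosed_of_closure_subset
    intro p hp
    obtain ⟨C, hC, hKC⟩ := K_bound K hK p 2
    obtain ⟨T, hT0, hT⟩ := exists_T C
    have hT1 : exp T ≤ 1 := by rw [← exp_zero]; exact exp_le_exp.2 hT0
    obtain ⟨q, hqZ, hqp⟩ := Metric.mem_closure_iff.1 hp (exp T) (exp_pos T)
    have hpq : ‖p - q‖ < exp T := by rwa [← dist_eq_norm]
    obtain ⟨ε, hε, hball⟩ := Metric.mem_nhds_iff.1 (mem_interior_iff_mem_nhds.1 hqZ)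
    obtain ⟨B, hB, hφB⟩ := K_bound φ hφ.continuous q (exp T)
    have hz : ∀ y, ‖y - q‖ < exp T → φ y = 0 := by
      apply sucp_ball φ K hφ hpde q C T hC hT
      · intro y hy
        apply hKC
        calc ‖y - p‖ = ‖(y - q) - (p - q)‖ := by congr 1; abel
          _ ≤ ‖y - q‖ + ‖p - q‖ := norm_sub_le _ _
          _ ≤ 2 := by linarith
      · exact (interior_subset hqZ : q ∈ {y | φ y = 0})
      · intro m hm
        have hm' : (1:ℝ) ≤ m := by exact_mod_cast hm
        refine ⟨B * exp (-((m - 1 / 2) * Real.log ε)), by positivity, fun t ht x => ?_⟩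
        rw [mul_assoc, ← exp_add]
        by_cases hlt : t < Real.log ε
        · have : φ (q + gam t x) = 0 := by
            apply hball
            simp only [Metric.mem_ball, dist_eq_norm, add_sub_cancel_left, gam_norm]
            rwa [← Real.lt_log_iff_exp_lt hε]
          rw [this, abs_zero]; positivity
        · have h1 := hφB (q + gam t x) (by simpa [gam_norm] using ht)
          have h2 : 1 ≤ exp (-((m - 1 / 2) * Real.log ε) + (m - 1 / 2) * t) := by
            apply one_le_exp
            nlinarith
          calc _ ≤ B * 1 := by simpa using h1
            _ ≤ _ := mul_le_mul_of_nonneg_left h2 hB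
    rw [mem_interior_iff_mem_nhds]
    filter_upwards [Metric.ball_mem_nhds p (show 0 < exp T - ‖p - q‖ by linarith)] with y hy
    apply hz
    rw [Metric.mem_ball, dist_eq_norm] at hy
    calc ‖y - q‖ = ‖(y - p) + (p - q)‖ := by congr 1; abel
      _ ≤ ‖y - p‖ + ‖p - q‖ := norm_add_le _ _
      _ < exp T := by linarith
  have := IsClopen.eq_univ ⟨hcl, isOpen_interior⟩ hne
  intro y
  have hy : y ∈ interior {y | φ y = 0} := by rw [this]; trivial
  exact (interior_subset hy : y ∈ {y | φ y = 0})

lemma bound_on {E F : Type*} [NormedAddCommGroup E] [ProperSpace E] [NormedAddCommGroup F]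
    (f : E → F) (hf : Continuous f) (R : ℝ) :
    ∃ M, ∀ z ∈ Metric.closedBall (0 : E) R, ‖f z‖ ≤ M :=
  (isCompact_closedBall (0 : E) R).exists_bound_of_continuousOn hf.continuousOn

/-- Quadratic vanishing at the origin. -/
lemma quad_bound {E : Type*} [NormedAddCommGroup E] [NormedSpace ℝ E] [ProperSpace E]
    (φ : E → ℝ) (hφ : ContDiff ℝ 2 φ) (h0 : φ 0 = 0) (hg : fderiv ℝ φ 0 = 0)
    (R : ℝ) : ∃ M, 0 ≤ M ∧ ∀ y, ‖y‖ ≤ R → |φ y| ≤ M * ‖y‖ ^ 2 := by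
  have h1 : ContDiff ℝ 1 (fderiv ℝ φ) := hφ.fderiv_right (by norm_num)
  have c2 : Continuous (fderiv ℝ (fderiv ℝ φ)) := h1.continuous_fderiv (by norm_num)
  obtain ⟨M, hM⟩ : ∃ M, ∀ z ∈ Metric.closedBall (0 : E) R, ‖fderiv ℝ (fderiv ℝ φ) z‖ ≤ M := by
    exact bound_on (F := E →L[ℝ] E →L[ℝ] ℝ) (fderiv ℝ (fderiv ℝ φ)) c2 R
  refine ⟨max M 0, le_max_right _ _, fun y hy => ?_⟩
  have hM' : ∀ z ∈ Metric.closedBall (0:E) ‖y‖, ‖fderiv ℝ (fderiv ℝ φ) z‖ ≤ max M 0 := fun z hz =>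
    le_max_of_le_left (hM z (Metric.closedBall_subset_closedBall hy hz))
  have s1 : ∀ z ∈ Metric.closedBall (0:E) ‖y‖, ‖fderiv ℝ φ z‖ ≤ max M 0 * ‖y‖ := by
    intro z hz
    have := (convex_closedBall (0:E) ‖y‖).norm_image_sub_le_of_norm_fderiv_le (𝕜 := ℝ)
      (fun w _ => (h1.differentiable (by norm_num)) w) hM'
      (Metric.mem_closedBall_self (norm_nonneg _)) hz
    rw [hg, sub_zero, sub_zero] at this
    refine this.trans (mul_le_mul_of_nonneg_left ?_ (le_max_right _ _))
    simpa using hz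
  have := (convex_closedBall (0:E) ‖y‖).norm_image_sub_le_of_norm_fderiv_le (𝕜 := ℝ)
      (fun w _ => (hφ.differentiable (by norm_num)) w) s1
      (Metric.mem_closedBall_self (norm_nonneg _)) (show y ∈ _ by simp)
  rw [h0, sub_zero, sub_zero, Real.norm_eq_abs] at this
  linarith [this, sq ‖y‖, mul_assoc (max M 0) ‖y‖ ‖y‖, congrArg (max M 0 * ·) (sq ‖y‖)]

lemma re_mode (α : ℂ) (m : ℕ) (x : ℝ) :
    (α * Complex.exp (m * x * Complex.I)).re = ‖α‖ * cos (Complex.arg α + m * x) := by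
  have e : α * Complex.exp (m * x * Complex.I)
      = ‖α‖ * Complex.exp (((Complex.arg α + m * x : ℝ) : ℂ) * Complex.I) := by
    nth_rewrite 1 [← Complex.norm_mul_exp_arg_mul_I α]
    rw [mul_assoc, ← Complex.exp_add]
    push_cast
    ring_nf
  rw [e, Complex.re_ofReal_mul, Complex.exp_ofReal_mul_I_re]

lemma rays (φ : E2 → ℝ) (hφ : Continuous φ) (h0 : φ 0 = 0) (m : ℕ) (hm : 2 ≤ m) (α : ℂ)
    (hα : α ≠ 0) (B T : ℝ) (h : ∀ t ≤ T, ∀ x : ℝ,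
      |φ (gam t x) - exp (m * t) * (α * Complex.exp (m * x * Complex.I)).re|
        ≤ B * exp ((m + 1 / 2) * t)) :
    ∃ y₁ y₂ y₃ : E2,
      φ y₁ ≠ 0 ∧ φ y₂ ≠ 0 ∧ φ y₃ ≠ 0 ∧
      connectedComponentIn {y | φ y ≠ 0} y₁ ≠ connectedComponentIn {y | φ y ≠ 0} y₂ ∧
      connectedComponentIn {y | φ y ≠ 0} y₁ ≠ connectedComponentIn {y | φ y ≠ 0} y₃ ∧
      connectedComponentIn {y | φ y ≠ 0} y₂ ≠ connectedComponentIn {y | φ y ≠ 0} y₃ := by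
  have hpos : 0 < ‖α‖ := norm_pos_iff.2 hα
  have hlim := (exp_lin_tendsto (1 / 2) (by norm_num)).const_mul |B|
  rw [mul_zero] at hlim
  obtain ⟨t0, ht0, ht0T⟩ := ((hlim.eventually (gt_mem_nhds hpos)).and
    (Filter.eventually_le_atBot T)).exists
  have key : ∀ t ≤ t0, ∀ x : ℝ,
      |φ (gam t x) - exp (m * t) * (‖α‖ * cos (Complex.arg α + m * x))| < exp (m * t) * ‖α‖ := by
    intro t ht x
    have h1 := h t (ht.trans ht0T) x
    rw [re_mode] at h1
    refine h1.trans_lt ?_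
    have e : exp ((m + 1 / 2) * t) = exp (m * t) * exp (1 / 2 * t) := by
      rw [← exp_add]; ring_nf
    rw [e]
    have h2 : |B| * exp (1 / 2 * t) ≤ |B| * exp (1 / 2 * t0) :=
      mul_le_mul_of_nonneg_left (exp_le_exp.2 (by linarith)) (abs_nonneg _)
    have h3 : B * exp (1 / 2 * t) ≤ |B| * exp (1 / 2 * t) :=
      mul_le_mul_of_nonneg_right (le_abs_self _) (exp_pos _).le
    calc B * (exp (m * t) * exp (1 / 2 * t)) = exp (m * t) * (B * exp (1 / 2 * t)) := by ring
      _ < _ := mul_lt_mul_of_pos_left (by linarith) (exp_pos _)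
  have kpos : ∀ x : ℝ, cos (Complex.arg α + m * x) = 1 → ∀ ρ, 0 < ρ → ρ ≤ exp t0 →
      0 < φ (pol ρ x) := by
    intro x hx ρ hρ hle
    have := key (Real.log ρ) ((Real.log_le_iff_le_exp hρ).2 hle) x
    rw [← pol_eq, Real.exp_log hρ, hx, mul_one] at this
    linarith [(abs_lt.1 this).1]
  have kneg : ∀ x : ℝ, cos (Complex.arg α + m * x) = -1 → ∀ ρ, 0 < ρ → ρ ≤ exp t0 →
      φ (pol ρ x) < 0 := by
    intro x hx ρ hρ hle
    have := key (Real.log ρ) ((Real.log_le_iff_le_exp hρ).2 hle) x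
    rw [← pol_eq, Real.exp_log hρ, hx] at this
    linarith [(abs_lt.1 this).2]
  have hm0 : (m : ℝ) ≠ 0 := by positivity
  apply three_of_rays φ hφ h0 m hm (exp t0) (-Complex.arg α / m) (exp_pos _)
  · apply kpos
    rw [show Complex.arg α + m * (-Complex.arg α / m) = 0 by field_simp; ring, cos_zero]
  · apply kneg
    rw [show Complex.arg α + m * (-Complex.arg α / m + π / m) = π by field_simp; ring, cos_pi]
  · apply kpos
    rw [show Complex.arg α + m * (-Complex.arg α / m + 2 * (π / m)) = 2 * π by field_simp; ring,
      cos_two_pi]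
  · apply kneg
    rw [show Complex.arg α + m * (-Complex.arg α / m + 3 * (π / m)) = π + 2 * π by
      field_simp; ring, cos_add_two_pi, cos_pi]

theorem main (K : E2 → ℝ) (hK : Continuous K) (φ : E2 → ℝ) (hφ : ContDiff ℝ 2 φ)
    (hne : ∃ y, φ y ≠ 0) (hpde : ∀ y : E2, planeLaplacian φ y + K y * φ y = 0)
    (h0 : φ 0 = 0) (hgrad : fderiv ℝ φ 0 = 0) :
    ∃ y₁ y₂ y₃ : E2,
      φ y₁ ≠ 0 ∧ φ y₂ ≠ 0 ∧ φ y₃ ≠ 0 ∧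
      connectedComponentIn {y | φ y ≠ 0} y₁ ≠ connectedComponentIn {y | φ y ≠ 0} y₂ ∧
      connectedComponentIn {y | φ y ≠ 0} y₁ ≠ connectedComponentIn {y | φ y ≠ 0} y₃ ∧
      connectedComponentIn {y | φ y ≠ 0} y₂ ≠ connectedComponentIn {y | φ y ≠ 0} y₃ := by
  by_contra hcon
  obtain ⟨C, hC, hKC⟩ := K_bound K hK 0 1
  obtain ⟨T, hT0, hT⟩ := exists_T C
  have hT1 : exp T ≤ 1 := by rw [← exp_zero]; exact exp_le_exp.2 hT0
  obtain ⟨M0, hM0, hq⟩ := quad_bound φ hφ h0 hgrad 1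
  have hKT : ∀ y, ‖y - 0‖ ≤ exp T → |K y| ≤ C := fun y hy => hKC y (hy.trans hT1)
  have hcyl := polar_cyl φ K hφ hpde 0
  have hgb := g_bound φ K 0 C T hKT
  have base : ∀ t ≤ T, ∀ x, |φ (0 + gam t x)| ≤ M0 * exp (2 * t) := by
    intro t ht x
    rw [zero_add]
    have e : exp (2 * t) = exp t ^ 2 := by rw [← exp_nat_mul]; norm_num
    have := hq (gam t x) (by rw [gam_norm]; exact (exp_le_exp.2 ht).trans hT1)
    rwa [gam_norm, ← e] at this
  have P : ∀ m : ℕ, ∃ M, 0 ≤ M ∧ ∀ t ≤ T, ∀ x,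
      |φ (0 + gam t x)| ≤ M * Real.exp (((m + 2 : ℕ) - 1 / 2) * t) := by
    intro m
    induction m with
    | zero =>
      refine ⟨M0, hM0, fun t ht x => (base t ht x).trans ?_⟩
      refine mul_le_mul_of_nonneg_left (exp_le_exp.2 ?_) hM0
      push_cast
      linarith
    | succ m ih =>
      obtain ⟨M, hM, hb⟩ := ih
      obtain ⟨α, hα⟩ := hcyl.step (m + 2) (by omega) M (C * M) T hM (by positivity) hb (by
        intro t ht x
        refine (hgb t ht x).trans ?_
        calc C * exp (2 * t) * |φ (0 + gam t x)|
            ≤ C * exp (2 * t) * (M * Real.exp (((m + 2 : ℕ) - 1 / 2) * t)) :=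
              mul_le_mul_of_nonneg_left (hb t ht x) (by positivity)
          _ = C * M * exp (2 * t + ((m + 2 : ℕ) - 1 / 2) * t) := by rw [exp_add]; ring
          _ ≤ _ := mul_le_mul_of_nonneg_left (exp_le_exp.2 (by linarith)) (by positivity))
      by_cases hz : α = 0
      · have hS : 0 ≤ SS (fun t x => φ (0 + gam t x)) T := tsum_nonneg fun _ => norm_nonneg _
        have := C0_nonneg
        refine ⟨SS (fun t x => φ (0 + gam t x)) T * exp (-(((m + 2 : ℕ) + 1 / 2) * T)) + C * M * C0,
          by positivity, fun t ht x => ?_⟩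
        have h2 := hα t ht x
        simp only [hz, zero_mul, Complex.zero_re, mul_zero, sub_zero] at h2
        have e : ((m + 2 : ℕ) + 1 / 2 : ℝ) * t = ((m + 1 + 2 : ℕ) - 1 / 2) * t := by
          push_cast
          ring
        rw [← e]
        exact h2
      · exfalso
        apply hcon
        refine rays φ hφ.continuous h0 (m + 2) (by omega) α hz
          (SS (fun t x => φ (0 + gam t x)) T * exp (-(((m + 2 : ℕ) + 1 / 2) * T)) + C * M * C0) T ?_
        intro t ht x
        have := hα t ht x
        rw [zero_add] at this
        exact this
  have hz := sucp_ball φ K hφ hpde 0 C T hC hT hKT h0 (by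
    intro m hm
    obtain ⟨M, hM, hb⟩ := P m
    refine ⟨M, hM, fun t ht x => (hb t ht x).trans ?_⟩
    refine mul_le_mul_of_nonneg_left (exp_le_exp.2 ?_) hM
    push_cast
    linarith)
  obtain ⟨y, hy⟩ := hne
  apply hy
  refine ucp φ K hK hφ hpde ⟨0, ?_⟩ y
  rw [mem_interior_iff_mem_nhds]
  filter_upwards [Metric.ball_mem_nhds (0:E2) (exp_pos T)] with z hz'
  exact hz z (by simpa using hz')

end Nodal

/-- Nodal domain count: if `φ ≢ 0` is a `C²` solution of `Δφ + Kφ = 0` on `ℝ²`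
with a smooth potential `K`, and both `φ` and its gradient vanish at the
origin, then the complement of the nodal set `{φ = 0}` has at least three
connected components. -/
theorem nodal_domain_count (K : EuclideanSpace ℝ (Fin 2) → ℝ) (hK : ContDiff ℝ (⊤ : ℕ∞) K)
    (φ : EuclideanSpace ℝ (Fin 2) → ℝ) (hφ : ContDiff ℝ 2 φ)
    (hne : ∃ y, φ y ≠ 0)
    (hpde : ∀ y : EuclideanSpace ℝ (Fin 2), planeLaplacian φ y + K y * φ y = 0)
    (h0 : φ 0 = 0) (hgrad : fderiv ℝ φ 0 = 0) :
    ∃ y₁ y₂ y₃ : EuclideanSpace ℝ (Fin 2),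
      φ y₁ ≠ 0 ∧ φ y₂ ≠ 0 ∧ φ y₃ ≠ 0 ∧
      connectedComponentIn {y | φ y ≠ 0} y₁ ≠ connectedComponentIn {y | φ y ≠ 0} y₂ ∧
      connectedComponentIn {y | φ y ≠ 0} y₁ ≠ connectedComponentIn {y | φ y ≠ 0} y₃ ∧
      connectedComponentIn {y | φ y ≠ 0} y₂ ≠ connectedComponentIn {y | φ y ≠ 0} y₃ := by
  exact Nodal.main K hK.continuous φ hφ hne hpde h0 hgrad
end
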